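/- arXiv:1109.3304 — 2 statements merged into one kernel-verified Lean document; each statement's English description precedes it below -/
import Mathlib

section
/- Let λ>0, 1<p<∞, 1<q<∞, 0≤c₁<c₂≤∞, let v be a non-negative measurable weight on (0,∞) with V(t)=∫_{c₁}^t v^{p'}, and let f≥0 be measurable. Set 𝓕(x)=∫_{c₁}^{c₂} e^{−x y^λ} f(y) v(y) dy and F(y)=∫_{c₁}^y f(t)v(t) dt. Assume ∫_0^∞ 𝓕(x)^q dx<∞, lim_{t→c₁⁺} t^{−λ} V(t)^{q/p'}=0 and lim_{t→c₂⁻} t^{−λ} V(t)^{q/p'}<∞. Then, with αᵠ:=min{2,2^{q−1}} and βᵠ:=2/(q−1) for 1<q≤2, βᵠ:=2^{q−1} for q>2, and with the convention c₂^{−λ}:=0 when c₂=∞, one has αᵠ λ q^{−2} ∫_{c₁}^{c₂} F(y)^q y^{−λ−1} dy + αᵠ q^{−2} F(c₂)^q c₂^{−λ} ≤ ∫_0^∞ 𝓕(x)^q dx ≤ (βᵠ λ/q) ∫_{c₁}^{c₂} F(y)^q y^{−λ−1} dy + (βᵠ/q) F(c₂)^q c₂^{−λ}. -/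
open MeasureTheory Set Filter Topology
open scoped ENNReal NNReal

noncomputable section

/-- The interval `(c₁, c₂)` on the half-line, where the upper endpoint `c₂` may be infinite. -/
def Ival (c₁ : ℝ) (c₂ : ℝ≥0∞) : Set ℝ := {y : ℝ | c₁ < y ∧ ENNReal.ofReal y < c₂}

/-- The tail integral of a measure `ν` against a measure `τ`, with the order of integration
exchanged. -/
theorem lintegral_weighted_tail_swap (ν τ : Measure ℝ) [SFinite ν] [SFinite τ] {w : ℝ → ℝ≥0∞}
    (hw : Measurable w) :
    ∫⁻ u, ν (Iio u) * w u ∂τ = ∫⁻ y, ∫⁻ u, (Ioi y).indicator 1 u * w u ∂τ ∂ν := by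
  have hmeas : Measurable fun z : ℝ × ℝ => (Ioi z.2).indicator (1 : ℝ → ℝ≥0∞) z.1 * w z.1 := by
    refine Measurable.mul ?_ (hw.comp measurable_fst)
    exact (measurable_one.indicator (measurableSet_lt measurable_snd measurable_fst) :
      Measurable ({z : ℝ × ℝ | z.2 < z.1}.indicator (1 : ℝ × ℝ → ℝ≥0∞)))
  rw [← lintegral_lintegral_swap hmeas.aemeasurable]
  refine lintegral_congr fun u => ?_
  have hind : ∀ y, (Ioi y).indicator (1 : ℝ → ℝ≥0∞) u * w u
      = (Iio u).indicator (fun _ => w u) y := by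
    intro y
    by_cases h : y < u <;> simp [h]
  simp_rw [hind]
  rw [lintegral_indicator measurableSet_Iio, setLIntegral_const, mul_comm]

theorem measurable_measure_Iio (ν : Measure ℝ) : Measurable fun u => ν (Iio u) :=
  Monotone.measurable fun _ _ h => measure_mono (Iio_subset_Iio h)

/-- A distribution function integrated against `τ` equals the tail of `τ` integrated against the
original measure. -/
theorem lintegral_measure_Iio (ν τ : Measure ℝ) [SFinite ν] [SFinite τ] :
    ∫⁻ u, ν (Iio u) ∂τ = ∫⁻ y, τ (Ioi y) ∂ν := by
  simpa [lintegral_indicator_one measurableSet_Ioi] using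
    lintegral_weighted_tail_swap ν τ (w := fun _ => 1) measurable_const

/-- Jensen's inequality for powers on a probability space. -/
theorem lintegral_rpow_le_lintegral_rpow {α : Type*} [MeasurableSpace α] (τ : Measure α)
    [IsProbabilityMeasure τ] {q : ℝ} (hq : 1 < q) {g : α → ℝ≥0∞} (hg : Measurable g) :
    (∫⁻ u, g u ∂τ) ^ q ≤ ∫⁻ u, g u ^ q ∂τ := by
  have hpq := Real.HolderConjugate.conjExponent hq
  have h := ENNReal.lintegral_mul_le_Lp_mul_Lq τ hpq hg.aemeasurable
    (measurable_const (a := (1 : ℝ≥0∞))).aemeasurable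
  simp only [Pi.mul_apply, mul_one, ENNReal.one_rpow, lintegral_const, measure_univ] at h
  calc _ ≤ ((∫⁻ u, g u ^ q ∂τ) ^ (1 / q)) ^ q := ENNReal.rpow_le_rpow h (by linarith)
    _ = _ := by rw [← ENNReal.rpow_mul, one_div_mul_cancel (by linarith), ENNReal.rpow_one]

/-- Minkowski's integral inequality for the distribution function of `ν`. -/
theorem lintegral_measure_Iio_rpow_le (ν τ : Measure ℝ) [SFinite ν] [IsFiniteMeasure τ] {q : ℝ}
    (hq : 1 < q) (hτ : ∀ n : ℕ, τ (Ioi (n : ℝ)) ≠ 0) :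
    ∫⁻ u, ν (Iio u) ^ q ∂τ ≤ (∫⁻ y, τ (Ioi y) ^ (1 / q) ∂ν) ^ q := by
  have hq0 : 0 < q := by linarith
  set L := ∫⁻ y, τ (Ioi y) ^ (1 / q) ∂ν with hL
  rcases eq_or_ne L ⊤ with hLtop | hLtop
  · simp [hLtop, ENNReal.top_rpow_of_pos hq0]
  have hG := measurable_measure_Iio ν
  have hfin : ∀ n : ℕ, ν (Iio (n : ℝ)) ≠ ⊤ := by
    intro n htop
    apply hLtop
    rw [eq_top_iff]
    calc ⊤ = τ (Ioi (n : ℝ)) ^ (1 / q) * ν (Iio (n : ℝ)) := by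
            rw [htop, ENNReal.mul_top]
            simp [ENNReal.rpow_eq_zero_iff, hτ n]
      _ = ∫⁻ _ in Iio (n : ℝ), τ (Ioi (n : ℝ)) ^ (1 / q) ∂ν := by rw [setLIntegral_const]
      _ ≤ ∫⁻ y in Iio (n : ℝ), τ (Ioi y) ^ (1 / q) ∂ν :=
            setLIntegral_mono' measurableSet_Iio fun y hy =>
              ENNReal.rpow_le_rpow (measure_mono (Ioi_subset_Ioi (le_of_lt hy))) (by positivity)
      _ ≤ L := setLIntegral_le_lintegral _ _
  have hpq : q.HolderConjugate q.conjExponent := Real.HolderConjugate.conjExponent hq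
  have key : ∀ n : ℕ, ∫⁻ u in Iio (n : ℝ), ν (Iio u) ^ q ∂τ ≤ L ^ q := by
    intro n
    set S := ∫⁻ u in Iio (n : ℝ), ν (Iio u) ^ q ∂τ with hS
    have hStop : S ≠ ⊤ := by
      refine ne_top_of_le_ne_top ?_ (setLIntegral_mono' (g := fun _ => ν (Iio (n : ℝ)) ^ q)
        measurableSet_Iio fun u hu =>
          ENNReal.rpow_le_rpow (measure_mono (Iio_subset_Iio (le_of_lt hu))) hq0.le)
      rw [setLIntegral_const]
      exact ENNReal.mul_ne_top (ENNReal.rpow_ne_top_of_nonneg hq0.le (hfin n))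
        (measure_ne_top _ _)
    rcases eq_or_ne S 0 with hS0 | hS0
    · simp [hS0]
    have hle : S ≤ L * S ^ (1 / q.conjExponent) := by
      calc S = ∫⁻ u in Iio (n : ℝ), ν (Iio u) * ν (Iio u) ^ (q - 1) ∂τ := by
            refine lintegral_congr fun u => ?_
            conv_lhs => rw [show q = 1 + (q - 1) by ring,
              ENNReal.rpow_add_of_nonneg _ _ zero_le_one (by linarith), ENNReal.rpow_one]
        _ = ∫⁻ y, ∫⁻ u in Iio (n : ℝ), (Ioi y).indicator 1 u * ν (Iio u) ^ (q - 1) ∂τ ∂ν :=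
            lintegral_weighted_tail_swap ν _ (hG.pow_const _)
        _ ≤ ∫⁻ y, τ (Ioi y) ^ (1 / q) * S ^ (1 / q.conjExponent) ∂ν := by
            refine lintegral_mono fun y => ?_
            refine (ENNReal.lintegral_mul_le_Lp_mul_Lq _ hpq
              (measurable_one.indicator measurableSet_Ioi).aemeasurable
              (hG.pow_const _).aemeasurable).trans ?_
            refine mul_le_mul' (ENNReal.rpow_le_rpow ?_ (by positivity)) (le_of_eq ?_)
            · calc _ ≤ ∫⁻ u, (Ioi y).indicator (1 : ℝ → ℝ≥0∞) u ^ q ∂τ :=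
                    setLIntegral_le_lintegral _ _
                _ = ∫⁻ u, (Ioi y).indicator (1 : ℝ → ℝ≥0∞) u ∂τ := by
                    refine lintegral_congr fun u => ?_
                    by_cases h : y < u <;> simp [h, hq0]
                _ = τ (Ioi y) := lintegral_indicator_one measurableSet_Ioi
            · simp_rw [← ENNReal.rpow_mul, hpq.sub_one_mul_conj]
              rfl
        _ = L * S ^ (1 / q.conjExponent) := by
            rw [lintegral_mul_const' _ _
              (ENNReal.rpow_ne_top_of_nonneg (by simpa using hpq.symm.nonneg) hStop)]
    have hsplit : S ^ (1 / q) * S ^ (1 / q.conjExponent) = S := by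
      rw [← ENNReal.rpow_add _ _ hS0 hStop, one_div, one_div, hpq.inv_add_inv_eq_one,
        ENNReal.rpow_one]
    have hroot : S ^ (1 / q) ≤ L := by
      have h0 : S ^ (1 / q.conjExponent) ≠ 0 := by
        simp [ENNReal.rpow_eq_zero_iff, hS0, hStop]
      have h1 : S ^ (1 / q.conjExponent) ≠ ⊤ :=
        ENNReal.rpow_ne_top_of_nonneg (by simpa using hpq.symm.nonneg) hStop
      rw [← ENNReal.mul_le_mul_iff_left h0 h1, hsplit]
      exact hle
    calc S = (S ^ (1 / q)) ^ q := by
          rw [← ENNReal.rpow_mul, one_div_mul_cancel hq0.ne', ENNReal.rpow_one]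
      _ ≤ L ^ q := ENNReal.rpow_le_rpow hroot hq0.le
  have hU : (⋃ n : ℕ, Iio (n : ℝ)) = univ :=
    eq_univ_of_forall fun x => mem_iUnion.2 (exists_nat_gt x)
  rw [← setLIntegral_univ, ← hU, setLIntegral_iUnion_of_directed]
  · exact iSup_le key
  · exact directed_of_isDirected_le fun m n h => Iio_subset_Iio (Nat.cast_le.2 h)

/-- The density of the probability measure on `(0, ∞)` with tail `y ↦ exp (-x y ^ lam)`. -/
def weibullDensity (lam x u : ℝ) : ℝ≥0∞ :=
  ENNReal.ofReal (x * (lam * u ^ (lam - 1)) * Real.exp (-(x * u ^ lam)))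

theorem measurable_weibullDensity (lam : ℝ) :
    Measurable fun z : ℝ × ℝ => weibullDensity lam z.1 z.2 := by
  unfold weibullDensity
  fun_prop

/-- The probability measure on `(0, ∞)` with tail `y ↦ exp (-x y ^ lam)`. -/
def weibull (lam x : ℝ) : Measure ℝ :=
  (volume.restrict (Ioi 0)).withDensity (weibullDensity lam x)

theorem weibull_Ioi {lam x y : ℝ} (hlam : 0 < lam) (hx : 0 < x) (hy : 0 ≤ y) :
    weibull lam x (Ioi y) = ENNReal.ofReal (Real.exp (-(x * y ^ lam))) := by
  rw [weibull, withDensity_apply _ measurableSet_Ioi, Measure.restrict_restrict measurableSet_Ioi,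
    inter_eq_left.2 (Ioi_subset_Ioi hy)]
  have hcont : ContinuousWithinAt (fun u => -Real.exp (-(x * u ^ lam))) (Ici y) y := by
    have : Continuous fun u : ℝ => u ^ lam := Real.continuous_rpow_const hlam.le
    exact Continuous.continuousWithinAt (by fun_prop)
  have hderiv : ∀ u ∈ Ioi y, HasDerivAt (fun u => -Real.exp (-(x * u ^ lam)))
      (x * (lam * u ^ (lam - 1)) * Real.exp (-(x * u ^ lam))) u := by
    intro u hu
    have h := (Real.hasDerivAt_rpow_const (x := u) (p := lam)
      (Or.inl (hy.trans_lt hu).ne')).const_mul x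
    exact h.fun_neg.exp.fun_neg.congr_deriv (by ring)
  have hpos : ∀ u ∈ Ioi y, 0 ≤ x * (lam * u ^ (lam - 1)) * Real.exp (-(x * u ^ lam)) := by
    intro u hu
    have : 0 < u := hy.trans_lt hu
    positivity
  have hlim : Tendsto (fun u : ℝ => -Real.exp (-(x * u ^ lam))) atTop (𝓝 0) := by
    rw [← neg_zero]
    refine Tendsto.neg (Real.tendsto_exp_neg_atTop_nhds_zero.comp ?_)
    exact (tendsto_rpow_atTop hlam).const_mul_atTop hx
  have hint := integrableOn_Ioi_deriv_of_nonneg hcont hderiv hpos hlim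
  simp only [weibullDensity]
  rw [← ofReal_integral_eq_lintegral_ofReal hint
    ((ae_restrict_iff' measurableSet_Ioi).2 (Eventually.of_forall hpos)),
    integral_Ioi_of_hasDerivAt_of_tendsto hcont hderiv hint hlim]
  simp

theorem isProbabilityMeasure_weibull {lam x : ℝ} (hlam : 0 < lam) (hx : 0 < x) :
    IsProbabilityMeasure (weibull lam x) := by
  constructor
  have h := weibull_Ioi hlam hx le_rfl
  rw [Real.zero_rpow hlam.ne', mul_zero, neg_zero, Real.exp_zero, ENNReal.ofReal_one] at h
  rw [← h, weibull, withDensity_apply _ MeasurableSet.univ, withDensity_apply _ measurableSet_Ioi]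
  simp

/-- Integrating the density in its parameter. -/
theorem lintegral_weibullDensity_param {lam r u : ℝ} (hlam : 0 < lam) (hr : 0 < r) (hu : 0 < u) :
    ∫⁻ x in Ioi (0 : ℝ), weibullDensity lam (r * x) u
      = ENNReal.ofReal (lam / r) * ENNReal.ofReal u ^ (-lam - 1) := by
  have ha : 0 < r * u ^ lam := by positivity
  have hI := Real.integral_rpow_mul_exp_neg_mul_Ioi (a := 2) (by norm_num) ha
  have hform : ∀ x : ℝ, r * x * (lam * u ^ (lam - 1)) * Real.exp (-(r * x * u ^ lam))
      = r * (lam * u ^ (lam - 1)) * (x ^ ((2 : ℝ) - 1) * Real.exp (-(r * u ^ lam * x))) := by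
    intro x
    rw [show (2 : ℝ) - 1 = 1 by norm_num, Real.rpow_one,
      show r * x * u ^ lam = r * u ^ lam * x by ring]
    ring
  have hint : IntegrableOn (fun x : ℝ => x ^ ((2 : ℝ) - 1) * Real.exp (-(r * u ^ lam * x)))
      (Ioi 0) := by
    by_contra h
    rw [integral_undef h] at hI
    have : 0 < (1 / (r * u ^ lam)) ^ (2 : ℝ) * Real.Gamma 2 :=
      mul_pos (by positivity) (Real.Gamma_pos_of_pos (by norm_num))
    linarith
  simp only [weibullDensity, hform]
  rw [← ofReal_integral_eq_lintegral_ofReal (hint.const_mul _)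
    ((ae_restrict_iff' measurableSet_Ioi).2 (Eventually.of_forall fun x hx => by
      have : (0 : ℝ) < x := hx
      simp only [Pi.zero_apply]
      positivity)), integral_const_mul, hI, Real.Gamma_two, mul_one,
    ENNReal.ofReal_rpow_of_pos hu, ← ENNReal.ofReal_mul (by positivity)]
  congr 1
  rw [Real.rpow_sub hu, Real.rpow_sub hu, Real.rpow_neg hu.le, Real.rpow_one, Real.rpow_two]
  field_simp

/-- Averaging a function against the measures `weibull lam (r * x)` over all scales. -/
theorem lintegral_lintegral_weibull {lam r : ℝ} (hlam : 0 < lam) (hr : 0 < r) {g : ℝ → ℝ≥0∞}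
    (hg : Measurable g) :
    ∫⁻ x in Ioi (0 : ℝ), ∫⁻ u, g u ∂(weibull lam (r * x))
      = ENNReal.ofReal (lam / r) *
        ∫⁻ u in Ioi (0 : ℝ), g u * ENNReal.ofReal u ^ (-lam - 1) := by
  have hk := measurable_weibullDensity lam
  have hk' : ∀ x, Measurable (weibullDensity lam x) := fun x =>
    hk.comp (measurable_const.prodMk measurable_id)
  simp_rw [weibull, lintegral_withDensity_eq_lintegral_mul _ (hk' _) hg, Pi.mul_apply]
  rw [lintegral_lintegral_swap, ← lintegral_const_mul' _ _ ENNReal.ofReal_ne_top]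
  · refine setLIntegral_congr_fun measurableSet_Ioi fun u hu => ?_
    have hm : Measurable fun x => weibullDensity lam (r * x) u :=
      hk.comp ((measurable_id.const_mul r).prodMk measurable_const)
    rw [lintegral_mul_const _ hm, lintegral_weibullDensity_param hlam hr hu]
    ring
  · have : Measurable fun z : ℝ × ℝ => weibullDensity lam (r * z.1) z.2 * g z.2 :=
      (hk.comp ((measurable_fst.const_mul r).prodMk measurable_snd)).mul (hg.comp measurable_snd)
    exact this.aemeasurable

/-- Two-sided bound of the `L^q` norm of a Laplace-type transform of `ν` by a weighted `L^q` norm of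
its distribution function. -/
theorem lintegral_laplace_rpow_bounds {lam q : ℝ} (hlam : 0 < lam) (hq : 1 < q)
    (ν : Measure ℝ) [SFinite ν] (hν : ∀ᵐ y ∂ν, 0 < y) :
    ENNReal.ofReal (lam / q) *
        ∫⁻ u in Ioi (0 : ℝ), ν (Iio u) ^ q * ENNReal.ofReal u ^ (-lam - 1)
      ≤ ∫⁻ x in Ioi (0 : ℝ), (∫⁻ y, ENNReal.ofReal (Real.exp (-(x * y ^ lam))) ∂ν) ^ q
    ∧ ∫⁻ x in Ioi (0 : ℝ), (∫⁻ y, ENNReal.ofReal (Real.exp (-(x * y ^ lam))) ∂ν) ^ q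
      ≤ ENNReal.ofReal lam *
        ∫⁻ u in Ioi (0 : ℝ), ν (Iio u) ^ q * ENNReal.ofReal u ^ (-lam - 1) := by
  have hq0 : 0 < q := by linarith
  have hG := (measurable_measure_Iio ν).pow_const q
  constructor
  · rw [← lintegral_lintegral_weibull hlam hq0 hG]
    refine setLIntegral_mono' measurableSet_Ioi fun x hx => ?_
    have hx : (0 : ℝ) < x := hx
    have := isProbabilityMeasure_weibull hlam (mul_pos hq0 hx)
    refine (lintegral_measure_Iio_rpow_le ν (weibull lam (q * x)) hq fun n => ?_).trans
      (le_of_eq ?_)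
    · rw [weibull_Ioi hlam (mul_pos hq0 hx) n.cast_nonneg]
      simp [Real.exp_pos]
    · congr 1
      refine lintegral_congr_ae (hν.mono fun y hy => ?_)
      simp only []
      rw [weibull_Ioi hlam (mul_pos hq0 hx) hy.le, ENNReal.ofReal_rpow_of_pos (Real.exp_pos _),
        ← Real.exp_mul]
      congr 2
      field_simp
  · have h := lintegral_lintegral_weibull hlam one_pos hG
    simp only [one_mul, div_one] at h
    rw [← h]
    refine setLIntegral_mono' measurableSet_Ioi fun x hx => ?_
    have := isProbabilityMeasure_weibull hlam hx
    refine le_trans (le_of_eq ?_)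
      (lintegral_rpow_le_lintegral_rpow (weibull lam x) hq (measurable_measure_Iio ν))
    rw [lintegral_measure_Iio]
    congr 1
    exact lintegral_congr_ae (hν.mono fun y hy => (weibull_Ioi hlam hx hy.le).symm)

theorem lintegral_Ici_rpow {lam b : ℝ} (hlam : 0 < lam) (hb : 0 < b) :
    ENNReal.ofReal lam * ∫⁻ u in Ici b, ENNReal.ofReal u ^ (-lam - 1)
      = ENNReal.ofReal b ^ (-lam) := by
  have ha : -lam - 1 < -1 := by linarith
  have h1 : ∫⁻ u in Ici b, ENNReal.ofReal u ^ (-lam - 1)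
      = ∫⁻ u in Ioi b, ENNReal.ofReal (u ^ (-lam - 1)) := by
    rw [setLIntegral_congr Ioi_ae_eq_Ici.symm]
    exact setLIntegral_congr_fun measurableSet_Ioi fun u hu =>
      ENNReal.ofReal_rpow_of_pos (hb.trans hu)
  rw [h1, ← ofReal_integral_eq_lintegral_ofReal (integrableOn_Ioi_rpow_of_lt ha hb)
    ((ae_restrict_iff' measurableSet_Ioi).2 (Eventually.of_forall fun u hu =>
      Real.rpow_nonneg (hb.trans hu).le _)), integral_Ioi_rpow_of_lt ha hb,
    ← ENNReal.ofReal_mul hlam.le, ENNReal.ofReal_rpow_of_pos hb]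
  congr 1
  rw [show -lam - 1 + 1 = -lam by ring]
  field_simp

theorem Ival_ofReal {c₁ b : ℝ} (hc₁ : 0 ≤ c₁) : Ival c₁ (ENNReal.ofReal b) = Ioo c₁ b := by
  ext y
  simp only [Ival, mem_ofPred_eq, mem_Ioo]
  refine and_congr_right fun h => ?_
  exact ENNReal.ofReal_lt_ofReal_iff_of_nonneg (hc₁.trans h.le)

theorem Ival_top (c₁ : ℝ) : Ival c₁ ⊤ = Ioi c₁ := by
  ext y
  simp [Ival]

theorem measurableSet_Ival (c₁ : ℝ) (c₂ : ℝ≥0∞) : MeasurableSet (Ival c₁ c₂) :=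
  measurableSet_Ioi.inter (measurableSet_lt ENNReal.measurable_ofReal measurable_const)

/-- The weighted integral of the distribution function of a measure concentrated on `(c₁, c₂)`,
split at the endpoints. -/
theorem lintegral_measure_Iio_rpow_split {lam q c₁ : ℝ} {c₂ : ℝ≥0∞} (hlam : 0 < lam) (hq : 0 < q)
    (hc₁ : 0 ≤ c₁) (hc : ENNReal.ofReal c₁ < c₂) (ν : Measure ℝ) (hν : ν (Ival c₁ c₂)ᶜ = 0) :
    ENNReal.ofReal lam *
        ∫⁻ u in Ioi (0 : ℝ), ν (Iio u) ^ q * ENNReal.ofReal u ^ (-lam - 1)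
      = ENNReal.ofReal lam *
          (∫⁻ u in Ival c₁ c₂, ν (Iio u) ^ q * ENNReal.ofReal u ^ (-lam - 1))
        + ν univ ^ q * c₂ ^ (-lam) := by
  have hlow : ∫⁻ u in Ioc 0 c₁, ν (Iio u) ^ q * ENNReal.ofReal u ^ (-lam - 1) = 0 := by
    rw [setLIntegral_congr_fun (g := fun _ => 0) measurableSet_Ioc fun u hu => ?_, lintegral_zero]
    have h0 : ν (Iio u) = 0 := measure_mono_null
      (show Iio u ⊆ (Ival c₁ c₂)ᶜ from fun y hy h => hu.2.not_gt (h.1.trans hy)) hν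
    simp [h0, hq]
  have hIoi : ∫⁻ u in Ioi (0 : ℝ), ν (Iio u) ^ q * ENNReal.ofReal u ^ (-lam - 1)
      = ∫⁻ u in Ioi c₁, ν (Iio u) ^ q * ENNReal.ofReal u ^ (-lam - 1) := by
    rw [← Ioc_union_Ioi_eq_Ioi hc₁, lintegral_union measurableSet_Ioi Ioc_disjoint_Ioi_same,
      hlow, zero_add]
  rw [hIoi]
  rcases eq_or_ne c₂ ⊤ with rfl | hc₂
  · simp [Ival_top, hlam]
  obtain ⟨b, hb, rfl⟩ : ∃ b : ℝ, 0 ≤ b ∧ ENNReal.ofReal b = c₂ :=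
    ⟨c₂.toReal, ENNReal.toReal_nonneg, ENNReal.ofReal_toReal hc₂⟩
  have hcb : c₁ < b := (ENNReal.ofReal_lt_ofReal_iff_of_nonneg hc₁).1 hc
  have hb0 : 0 < b := hc₁.trans_lt hcb
  rw [Ival_ofReal hc₁] at hν ⊢
  have hhigh : ∫⁻ u in Ici b, ν (Iio u) ^ q * ENNReal.ofReal u ^ (-lam - 1)
      = ν univ ^ q * ∫⁻ u in Ici b, ENNReal.ofReal u ^ (-lam - 1) := by
    rw [← lintegral_const_mul _ (by fun_prop)]
    refine setLIntegral_congr_fun measurableSet_Ici fun u hu => ?_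
    have hu' : ν (Iio u) = ν univ := by
      refine measure_congr (eventuallyEq_univ.2 (mem_ae_iff.2 (measure_mono_null ?_ hν)))
      exact compl_subset_compl.2 fun y hy => hy.2.trans_le hu
    simp only [hu']
  rw [← Ioo_union_Ici_eq_Ioi hcb, lintegral_union measurableSet_Ici
    (disjoint_left.2 fun y hy hy' => hy.2.not_ge hy'), hhigh, mul_add, mul_left_comm,
    lintegral_Ici_rpow hlam hb0]

theorem stmt0 (lam p q c₁ : ℝ) (c₂ : ℝ≥0∞)
    (hlam : 0 < lam) (hp : 1 < p) (hq1 : 1 < q)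
    (hc₁ : 0 ≤ c₁) (hc : ENNReal.ofReal c₁ < c₂)
    (v f : ℝ → ℝ) (hv : Measurable v) (hvpos : ∀ y, 0 ≤ v y)
    (hf : Measurable f) (hfpos : ∀ y, 0 ≤ f y)
    (p' : ℝ) (hp' : p' = p / (p - 1))
    -- `V s = ∫_{c₁}^{s} v^{p'}`, as a function of the (possibly infinite) upper endpoint
    (V : ℝ≥0∞ → ℝ≥0∞)
    (hV : V = fun s => ∫⁻ y in {y : ℝ | c₁ < y ∧ ENNReal.ofReal y < s},
      ENNReal.ofReal (v y) ^ p')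
    -- `F y = ∫_{c₁}^{y} f v`
    (F : ℝ → ℝ≥0∞)
    (hF : F = fun y => ∫⁻ t in Ioo c₁ y, ENNReal.ofReal (f t) * ENNReal.ofReal (v t))
    -- `F(c₂) = ∫_{c₁}^{c₂} f v`
    (Fall : ℝ≥0∞)
    (hFall : Fall = ∫⁻ t in Ival c₁ c₂, ENNReal.ofReal (f t) * ENNReal.ofReal (v t))
    -- `𝓕 x = ∫_{c₁}^{c₂} e^{-x y^λ} f(y) v(y) dy`
    (𝓕 : ℝ → ℝ≥0∞)
    (h𝓕 : 𝓕 = fun x => ∫⁻ y in Ival c₁ c₂,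
      ENNReal.ofReal (Real.exp (-(x * y ^ lam))) * ENNReal.ofReal (f y) * ENNReal.ofReal (v y))
    -- `∫_0^∞ 𝓕(x)^q dx < ∞`
    (hfin : (∫⁻ x in Ioi (0:ℝ), 𝓕 x ^ q) < ⊤)
    -- `lim_{t→c₁⁺} t^{-λ} V(t)^{q/p'} = 0`
    (hlim0 : Tendsto (fun s : ℝ≥0∞ => s ^ (-lam) * (V s) ^ (q / p'))
      (nhdsWithin (ENNReal.ofReal c₁) (Ioi (ENNReal.ofReal c₁))) (nhds 0))
    -- `lim_{t→c₂⁻} t^{-λ} V(t)^{q/p'} < ∞`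
    (hlim2 : ∃ L : ℝ≥0∞, L < ⊤ ∧ Tendsto (fun s : ℝ≥0∞ => s ^ (-lam) * (V s) ^ (q / p'))
      (nhdsWithin c₂ (Iio c₂)) (nhds L))
    (αq βq : ℝ)
    (hα : αq = min 2 (2 ^ (q - 1)))
    (hβ : βq = if q ≤ 2 then 2 / (q - 1) else 2 ^ (q - 1)) :
    ENNReal.ofReal (αq * lam / q ^ 2) *
        (∫⁻ y in Ival c₁ c₂, F y ^ q * ENNReal.ofReal y ^ (-lam - 1))
      + ENNReal.ofReal (αq / q ^ 2) * Fall ^ q * c₂ ^ (-lam)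
    ≤ (∫⁻ x in Ioi (0:ℝ), 𝓕 x ^ q)
    ∧ (∫⁻ x in Ioi (0:ℝ), 𝓕 x ^ q)
    ≤ ENNReal.ofReal (βq * lam / q) *
        (∫⁻ y in Ival c₁ c₂, F y ^ q * ENNReal.ofReal y ^ (-lam - 1))
      + ENNReal.ofReal (βq / q) * Fall ^ q * c₂ ^ (-lam) := by
  have hq0 : 0 < q := by linarith
  have hm : Measurable fun t => ENNReal.ofReal (f t) * ENNReal.ofReal (v t) := by fun_prop
  have hI := measurableSet_Ival c₁ c₂
  set ν : Measure ℝ := (volume.restrict (Ival c₁ c₂)).withDensity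
    (fun t => ENNReal.ofReal (f t) * ENNReal.ofReal (v t)) with hν
  have hcompl : ν (Ival c₁ c₂)ᶜ = 0 := by
    rw [hν, withDensity_apply _ hI.compl, Measure.restrict_restrict hI.compl]
    simp
  have hpos : ∀ᵐ y ∂ν, 0 < y :=
    measure_mono_null (compl_subset_compl.2 fun y hy => hc₁.trans_lt hy.1) hcompl
  have hFν : ∀ y ∈ Ival c₁ c₂, F y = ν (Iio y) := by
    intro y hy
    rw [hF, hν, withDensity_apply _ measurableSet_Iio, Measure.restrict_restrict measurableSet_Iio]
    have : Iio y ∩ Ival c₁ c₂ = Ioo c₁ y := by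
      ext t
      exact ⟨fun h => ⟨h.2.1, h.1⟩, fun h =>
        ⟨h.2, h.1, (ENNReal.ofReal_le_ofReal h.2.le).trans_lt hy.2⟩⟩
    rw [this]
  have hFallν : Fall = ν univ := by
    rw [hFall, hν, withDensity_apply _ MeasurableSet.univ, Measure.restrict_univ]
  have h𝓕ν : ∀ x, 𝓕 x = ∫⁻ y, ENNReal.ofReal (Real.exp (-(x * y ^ lam))) ∂ν := by
    intro x
    rw [h𝓕, hν, lintegral_withDensity_eq_lintegral_mul _ hm (by fun_prop)]
    refine lintegral_congr fun y => ?_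
    simp only [Pi.mul_apply]
    ring
  have hint : ∫⁻ y in Ival c₁ c₂, F y ^ q * ENNReal.ofReal y ^ (-lam - 1)
      = ∫⁻ y in Ival c₁ c₂, ν (Iio y) ^ q * ENNReal.ofReal y ^ (-lam - 1) :=
    setLIntegral_congr_fun hI fun y hy => by simp only [hFν y hy]
  have hsplit := lintegral_measure_Iio_rpow_split hlam hq0 hc₁ hc ν hcompl
  obtain ⟨hlower, hupper⟩ := lintegral_laplace_rpow_bounds hlam hq1 ν hpos
  rw [hsplit] at hupper
  rw [show lam / q = 1 / q * lam by ring, ENNReal.ofReal_mul (by positivity), mul_assoc,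
    hsplit] at hlower
  simp_rw [h𝓕ν]
  rw [hint, hFallν]
  have hα0 : 0 ≤ αq := by rw [hα]; positivity
  have hαq : αq ≤ q := by
    rw [hα]
    rcases le_total q 2 with h | h
    · refine (min_le_right _ _).trans ?_
      have := rpow_one_add_le_one_add_mul_self (s := 1) (by norm_num) (p := q - 1)
        (by linarith) (by linarith)
      norm_num at this
      linarith
    · exact (min_le_left _ _).trans h
  have hqβ : q ≤ βq := by
    rw [hβ]
    split_ifs with h
    · rw [le_div_iff₀ (by linarith)]
      nlinarith
    · have := one_add_mul_self_le_rpow_one_add (s := 1) (by norm_num) (p := q - 1)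
        (by linarith)
      norm_num at this
      linarith
  have factor : ∀ (c : ℝ) (A B : ℝ≥0∞), 0 ≤ c →
      ENNReal.ofReal (c * lam) * A + ENNReal.ofReal c * ν univ ^ q * B
        = ENNReal.ofReal c * (ENNReal.ofReal lam * A + ν univ ^ q * B) := by
    intro c A B h
    rw [ENNReal.ofReal_mul h]
    ring
  rw [show αq * lam / q ^ 2 = αq / q ^ 2 * lam by ring, show βq * lam / q = βq / q * lam by ring,
    factor _ _ _ (by positivity), factor _ _ _ (div_nonneg (hq0.le.trans hqβ) hq0.le)]
  constructor
  · refine le_trans (mul_le_mul_left (ENNReal.ofReal_le_ofReal ?_) _) hlower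
    rw [div_le_div_iff₀ (by positivity) hq0]
    nlinarith
  · refine hupper.trans (le_mul_of_one_le_left' ?_)
    rw [ENNReal.one_le_ofReal, one_le_div hq0]
    exact hqβ
end
end

section
/- Let λ>0 and 1<p≤q<∞, and let v be a non-negative measurable weight on (0,∞) with v^{p'} locally integrable. Define A(t)=t^{−λ/q}(∫_0^t v^{p'})^{1/p'} for t>0. Then the Laplace-type operator 𝓛 is compact from L^p to L^q if and only if sup_{t>0} A(t)<∞, lim_{t→0⁺} A(t)=0 and lim_{t→∞} A(t)=0. -/
open MeasureTheory Set Filter Topology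
open scoped ENNReal NNReal

noncomputable section

/-- The Laplace-type operator `𝓛f(x) = ∫_0^∞ e^{-x y^λ} f(y) v(y) dy`. -/
def Lap (lam : ℝ) (v f : ℝ → ℝ) : ℝ → ℝ :=
  fun x => ∫ y in Ioi (0:ℝ), Real.exp (-(x * y ^ lam)) * f y * v y

/-- `(∫_0^∞ |g|^r)^{1/r}`, the `L^r(0,∞)` (quasi-)norm. -/
def eN (r : ℝ) (g : ℝ → ℝ) : ℝ≥0∞ :=
  (∫⁻ x in Ioi (0:ℝ), ENNReal.ofReal |g x| ^ r) ^ (1/r)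

/-- Compactness of the Laplace-type operator from `L^p` to `L^q` (`q ≥ 1`): the image of the
closed unit ball of `L^p` is relatively compact in the complete space `L^q`; equivalently,
every sequence of the unit ball has a subsequence whose image is Cauchy in the `L^q` norm. -/
def LapCompact (lam p q : ℝ) (v : ℝ → ℝ) : Prop :=
  ∀ f : ℕ → ℝ → ℝ, (∀ n, Measurable (f n)) → (∀ n, eN p (f n) ≤ 1) →
    ∃ φ : ℕ → ℕ, StrictMono φ ∧
      ∀ ε : ℝ, 0 < ε → ∃ N : ℕ, ∀ m, N ≤ m → ∀ n, N ≤ n →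
        eN q (fun x => Lap lam v (f (φ m)) x - Lap lam v (f (φ n)) x) < ENNReal.ofReal ε

lemma exp_mul_rpow_le_lintegral {lam s x y : ℝ} (hlam : 0 < lam) (hs : 0 ≤ s) (hx : 0 ≤ x)
    (hy : 0 < y) :
    ENNReal.ofReal (Real.exp (-(x * y ^ lam)) * y ^ (-s)) ≤
      ENNReal.ofReal (2 ^ (s + 1)) * ∫⁻ t in Ioi y,
        ENNReal.ofReal (t ^ (-s - 1) * Real.exp (-(2 ^ (-lam) * x) * t ^ lam)) := by
  have h2 : (2:ℝ) ^ (-lam) * 2 ^ lam = 1 := by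
    rw [← Real.rpow_add two_pos]; simp
  have hconst : ENNReal.ofReal ((2 * y) ^ (-s - 1) * Real.exp (-(x * y ^ lam))) *
      ENNReal.ofReal y ≤ ∫⁻ t in Ioi y,
        ENNReal.ofReal (t ^ (-s - 1) * Real.exp (-(2 ^ (-lam) * x) * t ^ lam)) := by
    calc _ = ∫⁻ t in Ioo y (2 * y),
          ENNReal.ofReal ((2 * y) ^ (-s - 1) * Real.exp (-(x * y ^ lam))) := by
          rw [setLIntegral_const, Real.volume_Ioo]; congr 2; ring
      _ ≤ ∫⁻ t in Ioo y (2 * y),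
          ENNReal.ofReal (t ^ (-s - 1) * Real.exp (-(2 ^ (-lam) * x) * t ^ lam)) := by
          refine setLIntegral_mono' measurableSet_Ioo fun t ht => ENNReal.ofReal_le_ofReal ?_
          have ht0 : 0 < t := hy.trans ht.1
          refine mul_le_mul ?_ ?_ (Real.exp_nonneg _) (by positivity)
          · exact Real.rpow_le_rpow_of_nonpos ht0 ht.2.le (by linarith)
          · apply Real.exp_le_exp.2
            have : t ^ lam ≤ 2 ^ lam * y ^ lam := by
              rw [← Real.mul_rpow two_pos.le hy.le]
              exact Real.rpow_le_rpow ht0.le ht.2.le hlam.le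
            have h3 : 2 ^ (-lam) * x * t ^ lam ≤ x * y ^ lam := by
              calc 2 ^ (-lam) * x * t ^ lam ≤ 2 ^ (-lam) * x * (2 ^ lam * y ^ lam) := by gcongr
                _ = (2 ^ (-lam) * 2 ^ lam) * (x * y ^ lam) := by ring
                _ = _ := by rw [h2, one_mul]
            linarith
      _ ≤ _ := lintegral_mono_set Ioo_subset_Ioi_self
  refine le_trans (le_of_eq ?_) (mul_le_mul_right hconst _)
  rw [← ENNReal.ofReal_mul (by positivity), ← ENNReal.ofReal_mul (by positivity)]
  congr 1
  have e1 : (2:ℝ) ^ (s + 1) * 2 ^ (-s - 1) = 1 := by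
    rw [← Real.rpow_add two_pos]; ring_nf; simp
  have e2 : y ^ (-s - 1) * y = y ^ (-s) := by
    nth_rewrite 2 [← Real.rpow_one y]
    rw [← Real.rpow_add hy]; ring_nf
  rw [Real.mul_rpow two_pos.le hy.le, ← e2]
  linear_combination (-(y ^ (-s - 1) * y * Real.exp (-(x * y ^ lam)))) * e1

lemma lintegral_exp_mul_le_cumulative {lam s x : ℝ} (hlam : 0 < lam) (hs : 0 ≤ s) (hx : 0 ≤ x)
    {w : ℝ → ℝ≥0∞} (hw : Measurable w) :
    ∫⁻ y in Ioi (0:ℝ), ENNReal.ofReal (Real.exp (-(x * y ^ lam)) * y ^ (-s)) * w y ≤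
      ENNReal.ofReal (2 ^ (s + 1)) * ∫⁻ t in Ioi (0:ℝ),
        ENNReal.ofReal (t ^ (-s - 1) * Real.exp (-(2 ^ (-lam) * x) * t ^ lam)) *
          ∫⁻ y in Ioo (0:ℝ) t, w y := by
  set k : ℝ → ℝ≥0∞ := fun t =>
    ENNReal.ofReal (t ^ (-s - 1) * Real.exp (-(2 ^ (-lam) * x) * t ^ lam)) with hk
  have hkm : Measurable k := by fun_prop
  set F : ℝ → ℝ → ℝ≥0∞ := fun t y => (Iio t).indicator (fun y => k t * w y) y with hF
  have hFm : Measurable (Function.uncurry F) := by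
    have : Function.uncurry F =
        {z : ℝ × ℝ | z.2 < z.1}.indicator (fun z => k z.1 * w z.2) := by
      ext ⟨t, y⟩
      simp [F, Function.uncurry, indicator]
    rw [this]
    exact (by fun_prop : Measurable fun z : ℝ × ℝ => k z.1 * w z.2).indicator
      (measurableSet_lt measurable_snd measurable_fst)
  have hinner (t : ℝ) : k t * ∫⁻ y in Ioo (0:ℝ) t, w y = ∫⁻ y in Ioi (0:ℝ), F t y := by
    rw [← lintegral_const_mul _ hw, lintegral_indicator measurableSet_Iio,
      Measure.restrict_restrict measurableSet_Iio, inter_comm, Ioi_inter_Iio]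
  have hswap := lintegral_lintegral_swap (μ := volume.restrict (Ioi (0:ℝ)))
    (ν := volume.restrict (Ioi (0:ℝ))) (f := F) hFm.aemeasurable
  have hcum : ∫⁻ t in Ioi (0:ℝ), k t * ∫⁻ y in Ioo (0:ℝ) t, w y =
      ∫⁻ y in Ioi (0:ℝ), ∫⁻ t in Ioi (0:ℝ), F t y := by
    rw [lintegral_congr hinner, hswap]
  refine le_of_le_of_eq ?_ (congrArg (ENNReal.ofReal (2 ^ (s + 1)) * ·) hcum.symm)
  have hm : Measurable fun y => ∫⁻ t in Ioi (0:ℝ), F t y := hFm.lintegral_prod_left'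
  rw [← lintegral_const_mul _ hm]
  refine setLIntegral_mono' measurableSet_Ioi fun y hy => ?_
  have hy : 0 < y := hy
  have : ∫⁻ t in Ioi (0:ℝ), F t y = (∫⁻ t in Ioi y, k t) * w y := by
    have h1 : (fun t => F t y) = (Ioi y).indicator (fun t => k t * w y) := by
      ext t; simp [F, indicator]
    rw [h1, lintegral_indicator measurableSet_Ioi, Measure.restrict_restrict measurableSet_Ioi,
      Ioi_inter_Ioi, sup_eq_left.2 hy.le, lintegral_mul_const _ hkm]
  rw [this, ← mul_assoc]
  exact mul_le_mul_left (exp_mul_rpow_le_lintegral hlam hs hx hy) _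

/-- If `∫_0^t w ≤ t^{2λσ} (η + M 1_{[a,b]}(t))`, then `∫ e^{-x y^λ} y^{-λσ} w(y) dy` is bounded by
`x^{-σ}` times a multiple of `η` plus an exponentially decaying error. -/
lemma lintegral_exp_mul_le_of_cumulative_le {lam σ : ℝ} (hlam : 0 < lam) (hσ : 0 < σ) :
    ∃ C : ℝ≥0∞, C ≠ ⊤ ∧ ∀ (w : ℝ → ℝ≥0∞), Measurable w → ∀ (η M : ℝ≥0∞) (a b : ℝ), 0 < a →
      (∀ t, 0 < t → ∫⁻ y in Ioo (0:ℝ) t, w y ≤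
        ENNReal.ofReal (t ^ (2 * (lam * σ))) * (η + (Icc a b).indicator (fun _ => M) t)) →
      M ≠ ⊤ → ∃ B : ℝ≥0∞, B ≠ ⊤ ∧ (M = 0 → B = 0) ∧ ∀ x, 0 < x →
        ∫⁻ y in Ioi (0:ℝ), ENNReal.ofReal (Real.exp (-(x * y ^ lam)) * y ^ (-(lam * σ))) * w y ≤
          ENNReal.ofReal (x ^ (-σ)) * (C * η) +
            B * ENNReal.ofReal (Real.exp (-(2 ^ (-lam) * a ^ lam) * x)) := by
  set s := lam * σ with hs
  have hs0 : 0 < s := by positivity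
  refine ⟨ENNReal.ofReal (2 ^ (s + 1)) *
    ENNReal.ofReal ((2 ^ (-lam)) ^ (-σ) * (1 / lam) * Real.Gamma σ), by finiteness, ?_⟩
  intro w hw η M a b ha hV hM
  refine ⟨ENNReal.ofReal (2 ^ (s + 1)) * M * ∫⁻ t in Icc a b, ENNReal.ofReal (t ^ (s - 1)),
    ?_, fun h => by simp [h], ?_⟩
  · have : ∫⁻ t in Icc a b, ENNReal.ofReal (t ^ (s - 1)) ≠ ⊤ := by
      have hi : IntegrableOn (fun t : ℝ => t ^ (s - 1)) (Icc a b) := by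
        apply ContinuousOn.integrableOn_Icc
        intro t ht
        exact (Real.continuousAt_rpow_const _ _ (Or.inl (ha.trans_le ht.1).ne')).continuousWithinAt
      exact hi.lintegral_lt_top.ne
    finiteness
  intro x hx
  refine (lintegral_exp_mul_le_cumulative hlam hs0.le hx.le hw).trans ?_
  set c : ℝ := 2 ^ (-lam) with hc
  have hc0 : 0 < c := by positivity
  have step : ∫⁻ t in Ioi (0:ℝ),
        ENNReal.ofReal (t ^ (-s - 1) * Real.exp (-(c * x) * t ^ lam)) *
          ∫⁻ y in Ioo (0:ℝ) t, w y ≤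
      ∫⁻ t in Ioi (0:ℝ), (ENNReal.ofReal (t ^ (s - 1) * Real.exp (-(c * x) * t ^ lam)) * η +
        (Icc a b).indicator (fun t => ENNReal.ofReal (Real.exp (-(c * a ^ lam) * x)) * M *
          ENNReal.ofReal (t ^ (s - 1))) t) := by
    refine setLIntegral_mono' measurableSet_Ioi fun t ht => ?_
    have ht : 0 < t := ht
    have e1 : t ^ (-s - 1) * t ^ (2 * s) = t ^ (s - 1) := by
      rw [← Real.rpow_add ht]; ring_nf
    have e2 : ENNReal.ofReal (t ^ (-s - 1) * Real.exp (-(c * x) * t ^ lam)) *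
        ENNReal.ofReal (t ^ (2 * s)) =
        ENNReal.ofReal (t ^ (s - 1) * Real.exp (-(c * x) * t ^ lam)) := by
      rw [← ENNReal.ofReal_mul (by positivity), ← e1]; ring_nf
    refine (mul_le_mul_right (hV t ht) _).trans ?_
    rw [← mul_assoc, e2, mul_add]
    gcongr
    by_cases hab : t ∈ Icc a b
    · rw [indicator_of_mem hab, indicator_of_mem hab, ENNReal.ofReal_mul (by positivity),
        mul_comm (ENNReal.ofReal (Real.exp _)) M, mul_comm, mul_assoc M]
      refine mul_le_mul_right ?_ _
      rw [mul_comm]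
      refine mul_le_mul_left (ENNReal.ofReal_le_ofReal (Real.exp_le_exp.2 ?_)) _
      have : a ^ lam ≤ t ^ lam := Real.rpow_le_rpow ha.le hab.1 hlam.le
      have : c * x * a ^ lam ≤ c * x * t ^ lam := by gcongr
      linarith
    · simp [hab]
  refine (mul_le_mul_right step _).trans ?_
  have hm1 : Measurable fun t : ℝ => ENNReal.ofReal (t ^ (s - 1) * Real.exp (-(c * x) * t ^ lam)) :=
    by fun_prop
  have hgamma : ∫⁻ t in Ioi (0:ℝ), ENNReal.ofReal (t ^ (s - 1) * Real.exp (-(c * x) * t ^ lam)) =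
      ENNReal.ofReal ((c ^ (-σ) * (1 / lam) * Real.Gamma σ) * x ^ (-σ)) := by
    rw [← ofReal_integral_eq_lintegral_ofReal
      (integrableOn_rpow_mul_exp_neg_mul_rpow (by linarith) hlam (by positivity)),
      integral_rpow_mul_exp_neg_mul_rpow hlam (by linarith) (by positivity)]
    · congr 1
      have : (s - 1 + 1) / lam = σ := by rw [hs]; field_simp; ring
      rw [this, neg_div, this, Real.mul_rpow hc0.le hx.le]
      ring
    · filter_upwards [ae_restrict_mem measurableSet_Ioi] with t ht
      have : 0 < t := ht
      simp only [Pi.zero_apply]; positivity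
  rw [lintegral_add_left (hm1.mul_const η), lintegral_mul_const _ hm1, hgamma,
    lintegral_indicator measurableSet_Icc, Measure.restrict_restrict measurableSet_Icc,
    inter_eq_left.2 (show Icc a b ⊆ Ioi 0 from fun t ht => ha.trans_le ht.1),
    lintegral_const_mul _ (by fun_prop), ENNReal.ofReal_mul (by
      have := Real.Gamma_pos_of_pos hσ
      positivity)]
  apply le_of_eq
  ring

/-- The absolute Laplace-type integral `∫_0^∞ e^{-x y^λ} |f(y)| v(y) dy`. -/
def absLap (lam : ℝ) (v f : ℝ → ℝ) (x : ℝ) : ℝ≥0∞ :=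
  ∫⁻ y in Ioi (0:ℝ), ENNReal.ofReal (Real.exp (-(x * y ^ lam))) * ENNReal.ofReal |f y| *
    ENNReal.ofReal (v y)

/-- The weighted integral `∫_0^∞ e^{-x y^λ} y^{λr} |f(y)|^p dy`. -/
def powLap (lam p r : ℝ) (f : ℝ → ℝ) (x : ℝ) : ℝ≥0∞ :=
  ∫⁻ y in Ioi (0:ℝ), ENNReal.ofReal (Real.exp (-(x * y ^ lam)) * y ^ (lam * r)) *
    ENNReal.ofReal |f y| ^ p

/-- The weighted integral `∫_0^∞ e^{-x y^λ} y^{-λσ} v(y)^{p'} dy`. -/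
def weightLap (lam p' σ : ℝ) (v : ℝ → ℝ) (x : ℝ) : ℝ≥0∞ :=
  ∫⁻ y in Ioi (0:ℝ), ENNReal.ofReal (Real.exp (-(x * y ^ lam)) * y ^ (-(lam * σ))) *
    ENNReal.ofReal (v y) ^ p'

lemma absLap_le_weightLap_mul_powLap {lam p p' q : ℝ} (hq : 0 < q) (hpp : p.HolderConjugate p')
    {v f : ℝ → ℝ} (hv : Measurable v) (hf : Measurable f) (x : ℝ) :
    absLap lam v f x ≤ weightLap lam p' (p' / (2 * q)) v x ^ (1 / p') *
      powLap lam p (p / (2 * q)) f x ^ (1 / p) := by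
  have hp0 := hpp.pos
  have hp0' := hpp.symm.pos
  have hsum := hpp.inv_add_inv_eq_one
  set g : ℝ → ℝ≥0∞ := fun y =>
    ENNReal.ofReal (Real.exp (-(x * y ^ lam)) * y ^ (-(lam * (p' / (2 * q))))) ^ (1 / p') *
      ENNReal.ofReal (v y) with hg
  set h : ℝ → ℝ≥0∞ := fun y =>
    ENNReal.ofReal (Real.exp (-(x * y ^ lam)) * y ^ (lam * (p / (2 * q)))) ^ (1 / p) *
      ENNReal.ofReal |f y| with hh
  have hgm : Measurable g := by fun_prop
  have hhm : Measurable h := by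
    have : Measurable fun y => |f y| := hf.abs
    fun_prop
  have key := ENNReal.lintegral_mul_le_Lp_mul_Lq (volume.restrict (Ioi (0:ℝ))) hpp.symm
    hgm.aemeasurable hhm.aemeasurable
  have eg (y : ℝ) : g y ^ p' =
      ENNReal.ofReal (Real.exp (-(x * y ^ lam)) * y ^ (-(lam * (p' / (2 * q))))) *
        ENNReal.ofReal (v y) ^ p' := by
    rw [hg, ENNReal.mul_rpow_of_nonneg _ _ hp0'.le, ← ENNReal.rpow_mul,
      one_div_mul_cancel hp0'.ne', ENNReal.rpow_one]
  have eh (y : ℝ) : h y ^ p =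
      ENNReal.ofReal (Real.exp (-(x * y ^ lam)) * y ^ (lam * (p / (2 * q)))) *
        ENNReal.ofReal |f y| ^ p := by
    rw [hh, ENNReal.mul_rpow_of_nonneg _ _ hp0.le, ← ENNReal.rpow_mul,
      one_div_mul_cancel hp0.ne', ENNReal.rpow_one]
  simp_rw [eg, eh] at key
  refine le_trans (le_of_eq ?_) key
  refine setLIntegral_congr_fun measurableSet_Ioi fun y hy => ?_
  have hy : 0 < y := hy
  have e1 : ENNReal.ofReal (Real.exp (-(x * y ^ lam)) * y ^ (-(lam * (p' / (2 * q))))) ^ (1 / p') *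
      ENNReal.ofReal (Real.exp (-(x * y ^ lam)) * y ^ (lam * (p / (2 * q)))) ^ (1 / p) =
      ENNReal.ofReal (Real.exp (-(x * y ^ lam))) := by
    rw [ENNReal.ofReal_rpow_of_pos (by positivity), ENNReal.ofReal_rpow_of_pos (by positivity),
      ← ENNReal.ofReal_mul (by positivity)]
    congr 1
    rw [Real.mul_rpow (by positivity) (by positivity),
      Real.mul_rpow (by positivity) (by positivity), ← Real.rpow_mul hy.le, ← Real.rpow_mul hy.le,
      mul_mul_mul_comm, ← Real.rpow_add (by positivity), ← Real.rpow_add hy,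
      show 1 / p' + 1 / p = 1 by rw [one_div, one_div]; linarith, Real.rpow_one,
      show -(lam * (p' / (2 * q))) * (1 / p') + lam * (p / (2 * q)) * (1 / p) = 0 by
        field_simp; ring, Real.rpow_zero, mul_one]
  simp only [Pi.mul_apply, hg, hh]
  rw [← e1]
  ring

lemma powLap_le {lam p r : ℝ} (hr : 0 ≤ r) (hr1 : r ≤ 1) {f : ℝ → ℝ}
    (hfp : ∫⁻ y in Ioi (0:ℝ), ENNReal.ofReal |f y| ^ p ≤ 1) {x : ℝ} (hx : 0 < x) :
    powLap lam p r f x ≤ ENNReal.ofReal (x ^ (-r)) := by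
  calc powLap lam p r f x ≤
      ∫⁻ y in Ioi (0:ℝ), ENNReal.ofReal (x ^ (-r)) * ENNReal.ofReal |f y| ^ p := by
        refine setLIntegral_mono' measurableSet_Ioi fun y hy => ?_
        have hy : 0 < y := hy
        gcongr
        rw [Real.rpow_mul hy.le]
        set Y := y ^ lam
        have hY : 0 < Y := by positivity
        have h1 : (x * Y) ^ r ≤ Real.exp (x * Y) := by
          have h2 := Real.add_one_le_exp (x * Y)
          have h3 : 0 < x * Y := by positivity
          rcases le_total (x * Y) 1 with h | h
          · exact (Real.rpow_le_one h3.le h hr).trans (by linarith)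
          · calc (x * Y) ^ r ≤ (x * Y) ^ (1:ℝ) := Real.rpow_le_rpow_of_exponent_le h hr1
              _ ≤ _ := by rw [Real.rpow_one]; linarith
        rw [Real.mul_rpow hx.le hY.le] at h1
        rw [Real.exp_neg, Real.rpow_neg hx.le, inv_mul_le_iff₀ (Real.exp_pos _)]
        rw [← div_eq_mul_inv, le_div_iff₀ (by positivity)]
        linarith
    _ = ENNReal.ofReal (x ^ (-r)) * ∫⁻ y in Ioi (0:ℝ), ENNReal.ofReal |f y| ^ p :=
        lintegral_const_mul' _ _ ENNReal.ofReal_ne_top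
    _ ≤ _ := by simpa using mul_le_mul_right hfp (ENNReal.ofReal (x ^ (-r)))

lemma measurable_powLap {lam p r : ℝ} {f : ℝ → ℝ} (hf : Measurable f) :
    Measurable (powLap lam p r f) := by
  have : Measurable fun y => |f y| := hf.abs
  have : Measurable fun z : ℝ × ℝ =>
      ENNReal.ofReal (Real.exp (-(z.1 * z.2 ^ lam)) * z.2 ^ (lam * r)) *
        ENNReal.ofReal |f z.2| ^ p := by fun_prop
  exact this.lintegral_prod_right'

lemma lintegral_rpow_mul_powLap_le {lam p r : ℝ} (hr : 0 < r) {f : ℝ → ℝ} (hf : Measurable f)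
    (hfp : ∫⁻ y in Ioi (0:ℝ), ENNReal.ofReal |f y| ^ p ≤ 1) :
    ∫⁻ x in Ioi (0:ℝ), ENNReal.ofReal (x ^ (r - 1)) * powLap lam p r f x ≤
      ENNReal.ofReal (Real.Gamma r) := by
  have hfa : Measurable fun y => |f y| := hf.abs
  have hinner (x : ℝ) : ENNReal.ofReal (x ^ (r - 1)) * powLap lam p r f x =
      ∫⁻ y in Ioi (0:ℝ), ENNReal.ofReal (x ^ (r - 1)) *
        (ENNReal.ofReal (Real.exp (-(x * y ^ lam)) * y ^ (lam * r)) * ENNReal.ofReal |f y| ^ p) :=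
    (lintegral_const_mul' _ _ ENNReal.ofReal_ne_top).symm
  rw [lintegral_congr hinner, lintegral_lintegral_swap (by
    simp only [Function.uncurry_def]; fun_prop)]
  calc _ = ∫⁻ y in Ioi (0:ℝ), ENNReal.ofReal (Real.Gamma r) * ENNReal.ofReal |f y| ^ p := by
        refine setLIntegral_congr_fun measurableSet_Ioi fun y hy => ?_
        have hy : 0 < y := hy
        have hY : 0 < y ^ lam := by positivity
        have e1 : ∀ x ∈ Ioi (0:ℝ), ENNReal.ofReal (x ^ (r - 1)) *
            (ENNReal.ofReal (Real.exp (-(x * y ^ lam)) * y ^ (lam * r)) *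
              ENNReal.ofReal |f y| ^ p) =
            ENNReal.ofReal (x ^ (r - 1) * Real.exp (-(y ^ lam * x))) *
              (ENNReal.ofReal (y ^ (lam * r)) * ENNReal.ofReal |f y| ^ p) := by
          intro x hx
          have hx : 0 < x := hx
          rw [ENNReal.ofReal_mul (by positivity), ENNReal.ofReal_mul (by positivity),
            mul_comm x (y ^ lam)]
          ring
        rw [setLIntegral_congr_fun measurableSet_Ioi e1, lintegral_mul_const _ (by fun_prop),
          ← ofReal_integral_eq_lintegral_ofReal, Real.integral_rpow_mul_exp_neg_mul_Ioi hr hY,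
          ← mul_assoc, ← ENNReal.ofReal_mul (by
            have := Real.Gamma_pos_of_pos hr
            positivity)]
        · congr 2
          rw [Real.rpow_mul hy.le, Real.div_rpow zero_le_one hY.le, Real.one_rpow]
          field_simp
        · have := integrableOn_rpow_mul_exp_neg_mul_rpow (p := 1) (s := r - 1) (b := y ^ lam)
            (by linarith) one_pos hY
          simpa [IntegrableOn] using this
        · filter_upwards [ae_restrict_mem measurableSet_Ioi] with x hx
          have : 0 < x := hx
          simp only [Pi.zero_apply]; positivity
    _ = ENNReal.ofReal (Real.Gamma r) * ∫⁻ y in Ioi (0:ℝ), ENNReal.ofReal |f y| ^ p :=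
        lintegral_const_mul' _ _ ENNReal.ofReal_ne_top
    _ ≤ _ := by simpa using mul_le_mul_right hfp (ENNReal.ofReal (Real.Gamma r))

/-- If `∫ e^{-x y^λ} y^{-λσ} v^{p'} ≤ x^{-σ} κ`, then `∫ e^{-x y^λ} |f| v ≤ κ^{1/p'} x^{-1/q}` for `f`
in the unit ball of `L^p`. -/
lemma absLap_le {lam p p' q : ℝ} (hpq : p ≤ q) (hpp : p.HolderConjugate p')
    {v f : ℝ → ℝ} (hv : Measurable v) (hf : Measurable f)
    (hfp : ∫⁻ y in Ioi (0:ℝ), ENNReal.ofReal |f y| ^ p ≤ 1) {x : ℝ} (hx : 0 < x) {κ : ℝ≥0∞}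
    (hκ : weightLap lam p' (p' / (2 * q)) v x ≤ ENNReal.ofReal (x ^ (-(p' / (2 * q)))) * κ) :
    absLap lam v f x ≤ κ ^ (1 / p') * ENNReal.ofReal (x ^ (-(1 / q))) := by
  have hp0 := hpp.pos
  have hp0' := hpp.symm.pos
  have hq : 0 < q := hp0.trans_le hpq
  have hr1 : p / (2 * q) ≤ 1 := by rw [div_le_one (by positivity)]; linarith
  refine (absLap_le_weightLap_mul_powLap hq hpp hv hf x).trans ?_
  calc _ ≤ (ENNReal.ofReal (x ^ (-(p' / (2 * q)))) * κ) ^ (1 / p') *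
        ENNReal.ofReal (x ^ (-(p / (2 * q)))) ^ (1 / p) := by
        gcongr
        exact powLap_le (by positivity) hr1 hfp hx
    _ = κ ^ (1 / p') * ENNReal.ofReal (x ^ (-(1 / q))) := by
        rw [ENNReal.mul_rpow_of_nonneg _ _ (by positivity), mul_comm (_ ^ _) (κ ^ _), mul_assoc,
          ENNReal.ofReal_rpow_of_pos (by positivity), ENNReal.ofReal_rpow_of_pos (by positivity),
          ← ENNReal.ofReal_mul (by positivity), ← Real.rpow_mul hx.le, ← Real.rpow_mul hx.le,
          ← Real.rpow_add hx]
        congr 3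
        field_simp
        ring

lemma setLIntegral_absLap_rpow_le {lam p p' q : ℝ} (hpq : p ≤ q) (hpp : p.HolderConjugate p')
    {v f : ℝ → ℝ} (hv : Measurable v) (hf : Measurable f)
    (hfp : ∫⁻ y in Ioi (0:ℝ), ENNReal.ofReal |f y| ^ p ≤ 1) {E : Set ℝ} (hE : MeasurableSet E)
    (hE0 : E ⊆ Ioi 0) {κ : ℝ≥0∞}
    (hκ : ∀ x ∈ E, weightLap lam p' (p' / (2 * q)) v x ≤
      ENNReal.ofReal (x ^ (-(p' / (2 * q)))) * κ) :
    ∫⁻ x in E, absLap lam v f x ^ q ≤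
      κ ^ (q / p') * ENNReal.ofReal (Real.Gamma (p / (2 * q))) := by
  have hp0 := hpp.pos
  have hp0' := hpp.symm.pos
  have hq : 0 < q := hp0.trans_le hpq
  have hr0 : 0 < p / (2 * q) := by positivity
  have hr1 : p / (2 * q) ≤ 1 := by rw [div_le_one (by positivity)]; linarith
  have hqp : 0 ≤ q / p - 1 := by rw [sub_nonneg, le_div_iff₀ hp0]; linarith
  calc ∫⁻ x in E, absLap lam v f x ^ q
      ≤ ∫⁻ x in E, κ ^ (q / p') *
        (ENNReal.ofReal (x ^ (p / (2 * q) - 1)) * powLap lam p (p / (2 * q)) f x) := by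
        refine setLIntegral_mono' hE fun x hx => ?_
        have hx0 : 0 < x := hE0 hx
        set G := powLap lam p (p / (2 * q)) f x
        have hG : G ≤ ENNReal.ofReal (x ^ (-(p / (2 * q)))) := powLap_le hr0.le hr1 hfp hx0
        have hGpow : G ^ (q / p) ≤ ENNReal.ofReal (x ^ (-(p / (2 * q)))) ^ (q / p - 1) * G := by
          calc G ^ (q / p) = G ^ (q / p - 1) * G := by
                nth_rewrite 3 [← ENNReal.rpow_one G]
                rw [← ENNReal.rpow_add_of_nonneg _ _ hqp zero_le_one, sub_add_cancel]
            _ ≤ _ := by gcongr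
        calc absLap lam v f x ^ q
            ≤ (weightLap lam p' (p' / (2 * q)) v x ^ (1 / p') * G ^ (1 / p)) ^ q := by
              gcongr; exact absLap_le_weightLap_mul_powLap hq hpp hv hf x
          _ = weightLap lam p' (p' / (2 * q)) v x ^ (q / p') * G ^ (q / p) := by
              rw [ENNReal.mul_rpow_of_nonneg _ _ hq.le, ← ENNReal.rpow_mul, ← ENNReal.rpow_mul,
                one_div_mul_eq_div, one_div_mul_eq_div]
          _ ≤ (ENNReal.ofReal (x ^ (-(p' / (2 * q)))) * κ) ^ (q / p') *
              (ENNReal.ofReal (x ^ (-(p / (2 * q)))) ^ (q / p - 1) * G) := by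
              gcongr; exact hκ x hx
          _ = κ ^ (q / p') * (ENNReal.ofReal (x ^ (-(p' / (2 * q)))) ^ (q / p') *
              ENNReal.ofReal (x ^ (-(p / (2 * q)))) ^ (q / p - 1) * G) := by
              rw [ENNReal.mul_rpow_of_nonneg _ _ (by positivity)]; ring
          _ = _ := by
              rw [ENNReal.ofReal_rpow_of_pos (by positivity),
                ENNReal.ofReal_rpow_of_pos (by positivity), ← ENNReal.ofReal_mul (by positivity),
                ← Real.rpow_mul hx0.le, ← Real.rpow_mul hx0.le, ← Real.rpow_add hx0]
              congr 4
              field_simp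
              ring
    _ = κ ^ (q / p') * ∫⁻ x in E,
        (ENNReal.ofReal (x ^ (p / (2 * q) - 1)) * powLap lam p (p / (2 * q)) f x) :=
        lintegral_const_mul _ (by
          have := measurable_powLap (lam := lam) (p := p) (r := p / (2 * q)) hf
          fun_prop)
    _ ≤ _ := by
        gcongr
        exact (lintegral_mono_set hE0).trans (lintegral_rpow_mul_powLap_le hr0 hf hfp)

lemma tendsto_rpow_mul_exp_neg_mul_nhdsGT_zero {s : ℝ} (hs : 0 < s) (b : ℝ) :
    Tendsto (fun x : ℝ => x ^ s * Real.exp (-b * x)) (𝓝[>] 0) (𝓝 0) := by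
  have : ContinuousAt (fun x : ℝ => x ^ s * Real.exp (-b * x)) 0 :=
    (Real.continuousAt_rpow_const _ _ (Or.inr hs.le)).mul (by fun_prop)
  have h := this.tendsto
  simp only [Real.zero_rpow hs.ne', zero_mul] at h
  exact h.mono_left nhdsWithin_le_nhds

lemma eq_ofReal_rpow_mul_rpow {lam p' q : ℝ} (hp' : 0 < p') (hq : 0 < q) {t : ℝ} (ht : 0 < t)
    (W : ℝ≥0∞) :
    W = ENNReal.ofReal (t ^ (2 * (lam * (p' / (2 * q))))) *
      (ENNReal.ofReal t ^ (-(lam / q)) * W ^ (1 / p')) ^ p' := by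
  rw [ENNReal.mul_rpow_of_nonneg _ _ hp'.le, ← ENNReal.rpow_mul, ← ENNReal.rpow_mul,
    one_div_mul_cancel hp'.ne', ENNReal.rpow_one, ← mul_assoc,
    ENNReal.ofReal_rpow_of_pos ht, ← ENNReal.ofReal_mul (by positivity), ← Real.rpow_add ht,
    show 2 * (lam * (p' / (2 * q))) + -(lam / q) * p' = 0 by field_simp; ring]
  simp

lemma exists_weightLap_le {lam p' q : ℝ} (hlam : 0 < lam) (hp' : 0 < p') (hq : 0 < q)
    {v : ℝ → ℝ} (hv : Measurable v) {A : ℝ → ℝ≥0∞}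
    (hA : A = fun t => (ENNReal.ofReal t) ^ (-(lam/q)) *
      (∫⁻ y in Ioo (0:ℝ) t, ENNReal.ofReal (v y) ^ p') ^ (1/p'))
    (hsup : (⨆ t ∈ Ioi (0:ℝ), A t) < ⊤) :
    ∃ κ : ℝ≥0∞, κ ≠ ⊤ ∧ ∀ x, 0 < x → weightLap lam p' (p' / (2 * q)) v x ≤
      ENNReal.ofReal (x ^ (-(p' / (2 * q)))) * κ := by
  obtain ⟨C, hC, h⟩ := lintegral_exp_mul_le_of_cumulative_le (σ := p' / (2 * q)) hlam
    (by positivity)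
  set S := ⨆ t ∈ Ioi (0:ℝ), A t with hS
  obtain ⟨B, -, hB, hx⟩ := h (fun y => ENNReal.ofReal (v y) ^ p') (by fun_prop) (S ^ p') 0 1 1
    one_pos (fun t ht => by
      have hAS : A t ≤ S := le_iSup₂ (f := fun t (_ : t ∈ Ioi (0:ℝ)) => A t) t ht
      rw [hA] at hAS
      nth_rewrite 1 [eq_ofReal_rpow_mul_rpow (lam := lam) hp' hq ht (lintegral _ _)]
      simp only [indicator_zero, add_zero]
      gcongr) ENNReal.zero_ne_top
  refine ⟨C * S ^ p', ENNReal.mul_ne_top hC (ENNReal.rpow_ne_top_of_nonneg hp'.le hsup.ne),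
    fun x hx0 => (hx x hx0).trans ?_⟩
  simp [hB rfl]

lemma exists_weightLap_le_off_Icc {lam p' q : ℝ} (hlam : 0 < lam) (hp' : 0 < p') (hq : 0 < q)
    {v : ℝ → ℝ} (hv : Measurable v) {A : ℝ → ℝ≥0∞}
    (hA : A = fun t => (ENNReal.ofReal t) ^ (-(lam/q)) *
      (∫⁻ y in Ioo (0:ℝ) t, ENNReal.ofReal (v y) ^ p') ^ (1/p'))
    (hsup : (⨆ t ∈ Ioi (0:ℝ), A t) < ⊤) (h0 : Tendsto A (𝓝[>] 0) (𝓝 0))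
    (hinf : Tendsto A atTop (𝓝 0)) {ε : ℝ≥0∞} (hε : ε ≠ 0) :
    ∃ x₀ x₁ : ℝ, 0 < x₀ ∧ ∀ x, 0 < x → x ∉ Icc x₀ x₁ → weightLap lam p' (p' / (2 * q)) v x ≤
      ENNReal.ofReal (x ^ (-(p' / (2 * q)))) * ε := by
  set σ := p' / (2 * q) with hσdef
  have hσ : 0 < σ := by positivity
  obtain ⟨C, hC, h⟩ := lintegral_exp_mul_le_of_cumulative_le (σ := σ) hlam hσ
  set S := ⨆ t ∈ Ioi (0:ℝ), A t with hS
  have hε2 : 0 < ε / 2 := ENNReal.half_pos hε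
  set η := (ε / 2) / C
  have hη : 0 < η := ENNReal.div_pos hε2.ne' hC
  have hpow {l : Filter ℝ} (hl : Tendsto A l (𝓝 0)) : ∀ᶠ t in l, A t ^ p' ≤ η := by
    have h2 := ENNReal.continuous_rpow_const (y := p') |>.tendsto 0 |>.comp hl
    rw [ENNReal.zero_rpow_of_pos hp'] at h2
    exact ENNReal.tendsto_nhds_zero.1 h2 η hη
  obtain ⟨a, ha0, ha⟩ := (mem_nhdsGT_iff_exists_Ioo_subset).1 (hpow h0)
  have ha0 : 0 < a := ha0
  obtain ⟨b, hb⟩ := eventually_atTop.1 (hpow hinf)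
  obtain ⟨B, hBtop, -, hx⟩ := h (fun y => ENNReal.ofReal (v y) ^ p') (by fun_prop) η (S ^ p') a b
    ha0 (fun t ht => by
      have hAS : A t ≤ S := le_iSup₂ (f := fun t (_ : t ∈ Ioi (0:ℝ)) => A t) t ht
      have hW := eq_ofReal_rpow_mul_rpow (lam := lam) hp' hq ht
        (∫⁻ y in Ioo (0:ℝ) t, ENNReal.ofReal (v y) ^ p')
      rw [show ENNReal.ofReal t ^ (-(lam / q)) *
        (∫⁻ y in Ioo (0:ℝ) t, ENNReal.ofReal (v y) ^ p') ^ (1 / p') = A t by rw [hA]] at hW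
      rw [hW]
      gcongr
      by_cases hab : t ∈ Icc a b
      · rw [indicator_of_mem hab]
        exact le_add_left (by gcongr)
      · rw [indicator_of_notMem hab, add_zero]
        rcases lt_or_ge t a with hta | hta
        · exact ha ⟨ht, hta⟩
        · exact hb t (not_le.1 fun htb => hab ⟨hta, htb⟩).le)
    (ENNReal.rpow_ne_top_of_nonneg hp'.le hsup.ne)
  set c := (2:ℝ) ^ (-lam) * a ^ lam with hc
  have hc0 : 0 < c := by positivity
  have hsmall {l : Filter ℝ} (hl : Tendsto (fun x : ℝ => x ^ σ * Real.exp (-c * x)) l (𝓝 0)) :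
      ∀ᶠ x in l, B * ENNReal.ofReal (x ^ σ * Real.exp (-c * x)) ≤ ε / 2 := by
    have h2 := ENNReal.Tendsto.const_mul (a := B) (ENNReal.tendsto_ofReal hl) (Or.inr hBtop)
    rw [ENNReal.ofReal_zero, mul_zero] at h2
    exact ENNReal.tendsto_nhds_zero.1 h2 _ hε2
  obtain ⟨x₀, hx₀, h₀⟩ := (mem_nhdsGT_iff_exists_Ioo_subset).1
    (hsmall (tendsto_rpow_mul_exp_neg_mul_nhdsGT_zero hσ c))
  obtain ⟨x₁, h₁⟩ := eventually_atTop.1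
    (hsmall (tendsto_rpow_mul_exp_neg_mul_atTop_nhds_zero σ c hc0))
  refine ⟨x₀, x₁, hx₀, fun x hx0 hxI => (hx x hx0).trans ?_⟩
  have hxs : B * ENNReal.ofReal (x ^ σ * Real.exp (-c * x)) ≤ ε / 2 := by
    rcases lt_or_ge x x₀ with hlt | hge
    · exact h₀ ⟨hx0, hlt⟩
    · exact h₁ x (not_le.1 fun hle => hxI ⟨hge, hle⟩).le
  have hexp : ENNReal.ofReal (Real.exp (-c * x)) =
      ENNReal.ofReal (x ^ (-σ)) * ENNReal.ofReal (x ^ σ * Real.exp (-c * x)) := by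
    rw [← ENNReal.ofReal_mul (by positivity), ← mul_assoc, ← Real.rpow_add hx0]
    simp
  rw [hexp, mul_left_comm B, ← mul_add]
  gcongr
  calc C * η + B * ENNReal.ofReal (x ^ σ * Real.exp (-c * x)) ≤ ε / 2 + ε / 2 :=
        add_le_add ENNReal.mul_div_le hxs
    _ = ε := ENNReal.add_halves ε

lemma ofReal_abs_Lap_le {lam : ℝ} {v : ℝ → ℝ} (hvpos : ∀ y, 0 ≤ v y) (f : ℝ → ℝ) (x : ℝ) :
    ENNReal.ofReal |Lap lam v f x| ≤ absLap lam v f x := by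
  rw [← Real.enorm_eq_ofReal_abs]
  refine (enorm_integral_le_lintegral_enorm _).trans (le_of_eq ?_)
  refine lintegral_congr fun y => ?_
  rw [enorm_mul, enorm_mul, Real.enorm_eq_ofReal_abs, Real.enorm_eq_ofReal_abs,
    Real.enorm_eq_ofReal_abs, abs_of_nonneg (hvpos y), abs_of_pos (Real.exp_pos _)]

lemma measurable_Lap {lam : ℝ} {v f : ℝ → ℝ} (hv : Measurable v) (hf : Measurable f) :
    Measurable (Lap lam v f) := by
  have : StronglyMeasurable (Function.uncurry fun x y : ℝ =>
      Real.exp (-(x * y ^ lam)) * f y * v y) := by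
    apply Measurable.stronglyMeasurable
    simp only [Function.uncurry_def]
    fun_prop
  exact (this.integral_prod_right (ν := volume.restrict (Ioi (0:ℝ)))).measurable

lemma integrable_of_absLap_lt_top {lam : ℝ} {v f : ℝ → ℝ} (hv : Measurable v)
    (hvpos : ∀ y, 0 ≤ v y) (hf : Measurable f) {x : ℝ} (h : absLap lam v f x < ⊤) :
    Integrable (fun y => Real.exp (-(x * y ^ lam)) * f y * v y) (volume.restrict (Ioi (0:ℝ))) := by
  refine ⟨by fun_prop, lt_of_eq_of_lt (lintegral_congr fun y => ?_) h⟩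
  rw [enorm_mul, enorm_mul, Real.enorm_eq_ofReal_abs, Real.enorm_eq_ofReal_abs,
    Real.enorm_eq_ofReal_abs, abs_of_nonneg (hvpos y), abs_of_pos (Real.exp_pos _)]

lemma abs_exp_neg_sub_exp_neg_le {x z Y : ℝ} (hx : 0 < x) (hz : x / 2 ≤ z) (hY : 0 ≤ Y) :
    |Real.exp (-(x * Y)) - Real.exp (-(z * Y))| ≤
      |x - z| * (4 / x) * Real.exp (-(x / 4 * Y)) := by
  have hlip (s t : ℝ) (hs : x / 2 * Y ≤ s) (hst : s ≤ t) :
      |Real.exp (-s) - Real.exp (-t)| ≤ (t - s) * Real.exp (-(x / 2 * Y)) := by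
    rw [abs_of_nonneg (sub_nonneg.2 (Real.exp_le_exp.2 (by linarith)))]
    have h1 := Real.add_one_le_exp (s - t)
    have h2 : Real.exp (-t) = Real.exp (-s) * Real.exp (s - t) := by
      rw [← Real.exp_add]; ring_nf
    have h3 : Real.exp (-s) ≤ Real.exp (-(x / 2 * Y)) := Real.exp_le_exp.2 (by linarith)
    calc Real.exp (-s) - Real.exp (-t) = Real.exp (-s) * (1 - Real.exp (s - t)) := by
          rw [h2]; ring
      _ ≤ Real.exp (-s) * (t - s) :=
          mul_le_mul_of_nonneg_left (by linarith) (Real.exp_nonneg _)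
      _ ≤ Real.exp (-(x / 2 * Y)) * (t - s) := by gcongr
      _ = _ := mul_comm _ _
  have hmain : |Real.exp (-(x * Y)) - Real.exp (-(z * Y))| ≤
      |x - z| * Y * Real.exp (-(x / 2 * Y)) := by
    have hxx : x / 2 * Y ≤ x * Y := by nlinarith
    have hzz : x / 2 * Y ≤ z * Y := by gcongr
    rcases le_total x z with h | h
    · refine (hlip _ _ hxx (by gcongr)).trans (le_of_eq ?_)
      rw [abs_sub_comm, abs_of_nonneg (by linarith)]; ring
    · rw [abs_sub_comm]
      refine (hlip _ _ hzz (by gcongr)).trans (le_of_eq ?_)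
      rw [abs_of_nonneg (by linarith)]; ring
  refine hmain.trans ?_
  have h5 : x / 4 * Y ≤ Real.exp (x / 4 * Y) := by linarith [Real.add_one_le_exp (x / 4 * Y)]
  have h6 : Y * Real.exp (-(x / 2 * Y)) ≤ 4 / x * Real.exp (-(x / 4 * Y)) := by
    rw [show -(x / 2 * Y) = -(x / 4 * Y) + -(x / 4 * Y) by ring, Real.exp_add, ← mul_assoc]
    gcongr
    calc Y * Real.exp (-(x / 4 * Y)) = 4 / x * (x / 4 * Y) * Real.exp (-(x / 4 * Y)) := by
          field_simp
      _ ≤ 4 / x * Real.exp (x / 4 * Y) * Real.exp (-(x / 4 * Y)) := by gcongr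
      _ = 4 / x := by rw [mul_assoc, ← Real.exp_add]; simp
  calc |x - z| * Y * Real.exp (-(x / 2 * Y)) = |x - z| * (Y * Real.exp (-(x / 2 * Y))) := by ring
    _ ≤ |x - z| * (4 / x * Real.exp (-(x / 4 * Y))) := by gcongr
    _ = _ := by ring

/-- Local Lipschitz bound for the Laplace-type transform, in terms of the absolute integral. -/
lemma abs_Lap_sub_Lap_le {lam : ℝ} {v f : ℝ → ℝ} (hv : Measurable v)
    (hvpos : ∀ y, 0 ≤ v y) (hf : Measurable f) (hfin : ∀ x, 0 < x → absLap lam v f x < ⊤)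
    {x z : ℝ} (hx : 0 < x) (hz : x / 2 ≤ z) :
    |Lap lam v f x - Lap lam v f z| ≤ |x - z| * (4 / x) * (absLap lam v f (x / 4)).toReal := by
  have hz0 : 0 < z := by linarith
  have hvint := fun {x : ℝ} (hx : 0 < x) => integrable_of_absLap_lt_top hv hvpos hf (hfin x hx)
  rw [← ENNReal.ofReal_le_ofReal_iff (by positivity), ENNReal.ofReal_mul (by positivity),
    ENNReal.ofReal_toReal (hfin _ (by positivity)).ne, Lap, Lap,
    ← integral_sub (hvint hx) (hvint hz0), ← Real.enorm_eq_ofReal_abs, absLap,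
    ← lintegral_const_mul' _ _ ENNReal.ofReal_ne_top]
  refine (enorm_integral_le_lintegral_enorm _).trans ?_
  refine setLIntegral_mono' measurableSet_Ioi fun y hy => ?_
  have hy : 0 < y := hy
  rw [Real.enorm_eq_ofReal_abs, ← ENNReal.ofReal_mul (Real.exp_nonneg _),
    ← ENNReal.ofReal_mul (by positivity), ← ENNReal.ofReal_mul (by positivity)]
  apply ENNReal.ofReal_le_ofReal
  rw [← sub_mul, ← sub_mul, abs_mul, abs_mul, abs_of_nonneg (hvpos y), ← mul_assoc, ← mul_assoc]
  have := hvpos y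
  gcongr
  exact abs_exp_neg_sub_exp_neg_le hx hz (by positivity)

lemma measurable_absLap {lam : ℝ} {v f : ℝ → ℝ} (hv : Measurable v) (hf : Measurable f) :
    Measurable (absLap lam v f) := by
  have : Measurable fun y => |f y| := hf.abs
  have : Measurable fun z : ℝ × ℝ =>
      ENNReal.ofReal (Real.exp (-(z.1 * z.2 ^ lam))) * ENNReal.ofReal |f z.2| *
        ENNReal.ofReal (v z.2) := by fun_prop
  exact this.lintegral_prod_right'

lemma lintegral_le_one_of_eN_le_one {p : ℝ} (hp : 0 < p) {f : ℝ → ℝ} (h : eN p f ≤ 1) :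
    ∫⁻ y in Ioi (0:ℝ), ENNReal.ofReal |f y| ^ p ≤ 1 := by
  have := ENNReal.rpow_le_rpow h hp.le
  rwa [eN, ← ENNReal.rpow_mul, one_div_mul_cancel hp.ne', ENNReal.rpow_one,
    ENNReal.one_rpow] at this

/-- A sequence with uniformly bounded absolute Laplace-type integrals has a subsequence whose
transforms are pointwise Cauchy. -/
lemma exists_subseq_cauchySeq_Lap {lam : ℝ} {v : ℝ → ℝ} (hv : Measurable v)
    (hvpos : ∀ y, 0 ≤ v y) {f : ℕ → ℝ → ℝ} (hf : ∀ n, Measurable (f n)) {D : ℝ → ℝ≥0∞}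
    (hD : ∀ x, D x ≠ ⊤) (hfD : ∀ n x, 0 < x → absLap lam v (f n) x ≤ D x) :
    ∃ φ : ℕ → ℕ, StrictMono φ ∧
      ∀ x, 0 < x → CauchySeq fun n => Lap lam v (f (φ n)) x := by
  have hbound (n : ℕ) (x : ℝ) (hx : 0 < x) : |Lap lam v (f n) x| ≤ (D x).toReal :=
    (ENNReal.ofReal_le_iff_le_toReal (hD x)).1
      ((ofReal_abs_Lap_le hvpos (f n) x).trans (hfD n x hx))
  have hcomp : IsCompact (univ.pi fun i : {x : ℚ // 0 < x} =>
      Icc (-(D (i : ℚ)).toReal) (D (i : ℚ)).toReal) := isCompact_univ_pi fun i => isCompact_Icc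
  obtain ⟨a, -, φ, hφ, hlim⟩ := hcomp.tendsto_subseq
    (x := fun n (i : {x : ℚ // 0 < x}) => Lap lam v (f n) ((i : ℚ) : ℝ))
    (fun n i _ => abs_le.1 (hbound n _ (by exact_mod_cast i.2)))
  refine ⟨φ, hφ, fun x hx => Metric.cauchySeq_iff.2 fun ε hε => ?_⟩
  set K := 4 / x * (D (x / 4)).toReal with hK
  have hK0 : 0 ≤ K := by positivity
  obtain ⟨z, hz1, hz2⟩ := exists_rat_btwn
    (show x - min (x / 2) (ε / (3 * (K + 1))) < x from sub_lt_self _ (by positivity))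
  have hzx : x / 2 ≤ z := by linarith [min_le_left (x / 2) (ε / (3 * (K + 1)))]
  have hz0 : (0:ℝ) < z := by linarith
  have hclose (n : ℕ) : |Lap lam v (f n) x - Lap lam v (f n) z| < ε / 3 := by
    have h1 := abs_Lap_sub_Lap_le hv hvpos (hf n)
      (fun y hy => (hfD n y hy).trans_lt (hD y).lt_top) hx hzx
    have h2 : |x - z| < ε / (3 * (K + 1)) := by
      rw [abs_of_pos (by linarith)]
      linarith [min_le_right (x / 2) (ε / (3 * (K + 1)))]
    calc _ ≤ |x - z| * (4 / x) * (absLap lam v (f n) (x / 4)).toReal := h1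
      _ ≤ |x - z| * (4 / x) * (D (x / 4)).toReal := by
          gcongr
          · exact hD _
          · exact hfD n _ (by positivity)
      _ = |x - z| * K := by ring
      _ ≤ |x - z| * (K + 1) := by gcongr; linarith
      _ < ε / (3 * (K + 1)) * (K + 1) := by gcongr
      _ = ε / 3 := by field_simp
  have hzc : CauchySeq fun n => Lap lam v (f (φ n)) z :=
    ((tendsto_pi_nhds.1 hlim) ⟨z, by exact_mod_cast hz0⟩).cauchySeq
  obtain ⟨N, hN⟩ := Metric.cauchySeq_iff.1 hzc (ε / 3) (by positivity)
  refine ⟨N, fun m hm n hn => ?_⟩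
  have h1 := abs_lt.1 (hclose (φ m))
  have h2 := abs_lt.1 (hclose (φ n))
  have h3 := hN m hm n hn
  rw [Real.dist_eq, abs_lt] at h3 ⊢
  constructor <;> linarith [h1.1, h1.2, h2.1, h2.2, h3.1, h3.2]

lemma lapCompact_of_tendsto {lam p p' q : ℝ} (hlam : 0 < lam) (hpq : p ≤ q)
    (hpp : p.HolderConjugate p') {v : ℝ → ℝ} (hv : Measurable v) (hvpos : ∀ y, 0 ≤ v y)
    {A : ℝ → ℝ≥0∞}
    (hA : A = fun t => (ENNReal.ofReal t) ^ (-(lam/q)) *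
      (∫⁻ y in Ioo (0:ℝ) t, ENNReal.ofReal (v y) ^ p') ^ (1/p'))
    (hsup : (⨆ t ∈ Ioi (0:ℝ), A t) < ⊤) (h0 : Tendsto A (𝓝[>] 0) (𝓝 0))
    (hinf : Tendsto A atTop (𝓝 0)) :
    LapCompact lam p q v := by
  intro f hf hfn
  have hp0 := hpp.pos
  have hp0' := hpp.symm.pos
  have hq1 : 1 ≤ q := hpp.lt.le.trans hpq
  have hq : 0 < q := hp0.trans_le hpq
  have hfp (n : ℕ) := lintegral_le_one_of_eN_le_one hp0 (hfn n)
  obtain ⟨κ, hκtop, hκ⟩ := exists_weightLap_le hlam hp0' hq hv hA hsup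
  have hκtop' : κ ^ (1 / p') ≠ ⊤ := ENNReal.rpow_ne_top_of_nonneg (by positivity) hκtop
  have hD (n : ℕ) (x : ℝ) (hx : 0 < x) : absLap lam v (f n) x ≤
      κ ^ (1 / p') * ENNReal.ofReal (x ^ (-(1 / q))) :=
    absLap_le hpq hpp hv (hf n) (hfp n) hx (hκ x hx)
  obtain ⟨φ, hφ, hcauchy⟩ := exists_subseq_cauchySeq_Lap hv hvpos hf
    (D := fun x => κ ^ (1 / p') * ENNReal.ofReal (x ^ (-(1 / q))))
    (fun x => ENNReal.mul_ne_top hκtop' ENNReal.ofReal_ne_top) hD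
  refine ⟨φ, hφ, fun ε hε => ?_⟩
  set T := ENNReal.ofReal ε ^ q with hT
  have hTtop : T ≠ ⊤ := ENNReal.rpow_ne_top_of_nonneg hq.le ENNReal.ofReal_ne_top
  have hT0 : T ≠ 0 := (ENNReal.rpow_pos (ENNReal.ofReal_pos.2 hε) ENNReal.ofReal_ne_top).ne'
  have hT2 : T / 2 ≠ 0 := (ENNReal.half_pos hT0).ne'
  set Γ := ENNReal.ofReal (Real.Gamma (p / (2 * q)))
  set c : ℝ≥0∞ := 2 ^ (q - 1) * (Γ + Γ) with hc
  have h2q : (2:ℝ≥0∞) ^ (q - 1) ≠ ⊤ :=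
    ENNReal.rpow_ne_top_of_nonneg (by linarith) ENNReal.ofNat_ne_top
  have hctop : c ≠ ⊤ := ENNReal.mul_ne_top h2q (by finiteness)
  set η := T / 2 / c
  have hη : η ≠ 0 := (ENNReal.div_pos hT2 hctop).ne'
  have hη' : η ^ (p' / q) ≠ 0 := by
    have hpos : 0 < p' / q := by positivity
    simp [ENNReal.rpow_eq_zero_iff, hη, hpos.not_gt]
  obtain ⟨x₀, x₁, hx₀, hoff⟩ := exists_weightLap_le_off_Icc hlam hp0' hq hv hA hsup h0 hinf hη'
  set E := Ioi (0:ℝ) \ Icc x₀ x₁ with hE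
  have hEm : MeasurableSet E := measurableSet_Ioi.diff measurableSet_Icc
  have htri (m n : ℕ) (x : ℝ) : ENNReal.ofReal |Lap lam v (f m) x - Lap lam v (f n) x| ≤
      absLap lam v (f m) x + absLap lam v (f n) x :=
    (ENNReal.ofReal_le_ofReal (abs_sub _ _)).trans <| ENNReal.ofReal_add_le.trans <|
      add_le_add (ofReal_abs_Lap_le hvpos _ _) (ofReal_abs_Lap_le hvpos _ _)
  have hEint (n : ℕ) : ∫⁻ x in E, absLap lam v (f n) x ^ q ≤ η * Γ := by
    have := setLIntegral_absLap_rpow_le hpq hpp hv (hf n) (hfp n) hEm sdiff_subset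
      (fun x hx => hoff x hx.1 hx.2)
    rwa [← ENNReal.rpow_mul, div_mul_div_cancel₀ hq.ne', div_self hp0'.ne',
      ENNReal.rpow_one] at this
  have htail (m n : ℕ) :
      ∫⁻ x in E, ENNReal.ofReal |Lap lam v (f m) x - Lap lam v (f n) x| ^ q ≤ T / 2 := by
    calc _ ≤ ∫⁻ x in E, 2 ^ (q - 1) * (absLap lam v (f m) x ^ q + absLap lam v (f n) x ^ q) := by
          refine lintegral_mono fun x => ?_
          exact (ENNReal.rpow_le_rpow (htri m n x) hq.le).trans
            (ENNReal.rpow_add_le_mul_rpow_add_rpow _ _ hq1)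
      _ = 2 ^ (q - 1) * ((∫⁻ x in E, absLap lam v (f m) x ^ q) +
            ∫⁻ x in E, absLap lam v (f n) x ^ q) := by
          rw [lintegral_const_mul' _ _ h2q,
            lintegral_add_left ((measurable_absLap hv (hf m)).pow_const q)]
      _ ≤ 2 ^ (q - 1) * (η * Γ + η * Γ) := by gcongr <;> apply hEint
      _ = c * η := by rw [hc]; ring
      _ ≤ T / 2 := ENNReal.mul_div_le
  have hmid : Tendsto (fun z : ℕ × ℕ => ∫⁻ x in Icc x₀ x₁,
      ENNReal.ofReal |Lap lam v (f (φ z.1)) x - Lap lam v (f (φ z.2)) x| ^ q) atTop (𝓝 0) := by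
    set b := κ ^ (1 / p') * ENNReal.ofReal (x₀ ^ (-(1 / q))) with hb
    have hbtop : b ≠ ⊤ := ENNReal.mul_ne_top hκtop' ENNReal.ofReal_ne_top
    have hJb (n : ℕ) (x : ℝ) (hx : x ∈ Icc x₀ x₁) : absLap lam v (f n) x ≤ b := by
      refine (hD n x (hx₀.trans_le hx.1)).trans ?_
      exact mul_le_mul_right (ENNReal.ofReal_le_ofReal
        (Real.rpow_le_rpow_of_nonpos hx₀ hx.1 (neg_nonpos.2 (by positivity)))) _
    have := tendsto_lintegral_filter_of_dominated_convergence
      (μ := volume.restrict (Icc x₀ x₁)) (l := (atTop : Filter (ℕ × ℕ)))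
      (F := fun z x => ENNReal.ofReal |Lap lam v (f (φ z.1)) x - Lap lam v (f (φ z.2)) x| ^ q)
      (f := fun _ => 0) (fun _ => (b + b) ^ q)
      (Eventually.of_forall fun z => by
        have h1 := measurable_Lap (lam := lam) hv (hf (φ z.1))
        have h2 := measurable_Lap (lam := lam) hv (hf (φ z.2))
        exact (h1.sub h2).abs.ennreal_ofReal.pow_const q)
      (Eventually.of_forall fun z => by
        filter_upwards [ae_restrict_mem measurableSet_Icc] with x hx
        exact ENNReal.rpow_le_rpow ((htri _ _ x).trans (add_le_add (hJb _ x hx) (hJb _ x hx)))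
          hq.le)
      (by
        rw [setLIntegral_const, Real.volume_Icc]
        exact ENNReal.mul_ne_top (ENNReal.rpow_ne_top_of_nonneg hq.le (by finiteness))
          ENNReal.ofReal_ne_top)
      (by
        filter_upwards [ae_restrict_mem measurableSet_Icc] with x hx
        have h1 : Tendsto (fun z : ℕ × ℕ => |Lap lam v (f (φ z.1)) x - Lap lam v (f (φ z.2)) x|)
            atTop (𝓝 0) := by
          have := cauchySeq_iff_tendsto_dist_atTop_0.1 (hcauchy x (hx₀.trans_le hx.1))
          simpa [Real.dist_eq] using this
        have h2 := (ENNReal.continuous_rpow_const (y := q)).tendsto _ |>.comp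
          (ENNReal.tendsto_ofReal h1)
        simpa [ENNReal.zero_rpow_of_pos hq, Function.comp_def] using h2)
    simpa using this
  obtain ⟨N, hN⟩ := eventually_atTop_prod_self'.1
    (hmid.eventually (gt_mem_nhds (pos_iff_ne_zero.2 hT2)))
  refine ⟨N, fun m hm n hn => ?_⟩
  have hlt : ∫⁻ x in Ioi (0:ℝ),
      ENNReal.ofReal |Lap lam v (f (φ m)) x - Lap lam v (f (φ n)) x| ^ q < T := by
    calc _ ≤ ∫⁻ x in E ∪ Icc x₀ x₁,
          ENNReal.ofReal |Lap lam v (f (φ m)) x - Lap lam v (f (φ n)) x| ^ q :=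
          lintegral_mono_set (by rw [hE, sdiff_union_self]; exact subset_union_left)
      _ ≤ _ := lintegral_union_le _ _ _
      _ < T / 2 + T / 2 := ENNReal.add_lt_add_of_le_of_lt
          ((htail _ _).trans_lt (ENNReal.half_lt_self hT0 hTtop |>.trans hTtop.lt_top)).ne
          (htail _ _) (hN m hm n hn)
      _ = T := ENNReal.add_halves T
  have := ENNReal.rpow_lt_rpow hlt (show 0 < 1 / q by positivity)
  rwa [hT, ← ENNReal.rpow_mul, mul_one_div_cancel hq.ne', ENNReal.rpow_one] at this

/-- The normalized extremal function of Hölder's inequality on `(s, t)`. -/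
lemma exists_extremal_function {lam p p' : ℝ} (hlam : 0 < lam)
    (hpp : p.HolderConjugate p') {v : ℝ → ℝ} (hv : Measurable v) (hvpos : ∀ y, 0 ≤ v y)
    {s t : ℝ} (hs : 0 < s) (hvint : IntegrableOn (fun y => v y ^ p') (Ioo s t))
    (hu : 0 < ∫ y in Ioo s t, v y ^ p') :
    ∃ f : ℝ → ℝ, Measurable f ∧ eN p f ≤ 1 ∧ ∀ x, 0 < x →
      Real.exp (-(x * t ^ lam)) * (∫ y in Ioo s t, v y ^ p') ^ (1 / p') ≤ Lap lam v f x ∧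
      Lap lam v f x ≤ Real.exp (-(x * s ^ lam)) * (∫ y in Ioo s t, v y ^ p') ^ (1 / p') := by
  have hp0 := hpp.pos
  have hp0' := hpp.symm.pos
  have hsub : Ioo s t ⊆ Ioi 0 := fun y hy => hs.trans hy.1
  set u := ∫ y in Ioo s t, v y ^ p' with hudef
  refine ⟨(Ioo s t).indicator fun y => v y ^ (p' - 1) / u ^ (1 / p),
    (by fun_prop : Measurable fun y => v y ^ (p' - 1) / u ^ (1 / p)).indicator measurableSet_Ioo,
    ?_, fun x hx => ?_⟩
  · have hpow (y : ℝ) : ENNReal.ofReal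
        |(Ioo s t).indicator (fun y => v y ^ (p' - 1) / u ^ (1 / p)) y| ^ p =
        (Ioo s t).indicator (fun y => ENNReal.ofReal (v y ^ p' / u)) y := by
      by_cases hy : y ∈ Ioo s t
      · have := hvpos y
        rw [indicator_of_mem hy, indicator_of_mem hy, abs_of_nonneg (by positivity),
          ENNReal.ofReal_rpow_of_nonneg (by positivity) hp0.le,
          Real.div_rpow (by positivity) (by positivity), ← Real.rpow_mul this,
          ← Real.rpow_mul hu.le, hpp.symm.sub_one_mul_conj, one_div_mul_cancel hp0.ne',
          Real.rpow_one]
      · simp [hy, ENNReal.zero_rpow_of_pos hp0]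
    rw [eN, lintegral_congr hpow, lintegral_indicator measurableSet_Ioo,
      Measure.restrict_restrict measurableSet_Ioo, inter_eq_left.2 hsub,
      ← ofReal_integral_eq_lintegral_ofReal (hvint.div_const u)
        (Eventually.of_forall fun y => by have := hvpos y; simp only [Pi.zero_apply]; positivity),
      integral_div, div_self hu.ne']
    simp
  · set g : ℝ → ℝ := fun y => v y ^ p' / u ^ (1 / p) with hg
    have hg0 (y : ℝ) : 0 ≤ g y := by have := hvpos y; positivity
    have hgi : IntegrableOn g (Ioo s t) := hvint.div_const _
    have hgint : ∫ y in Ioo s t, g y = u ^ (1 / p') := by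
      rw [hg, integral_div, ← hudef, div_eq_iff (by positivity), ← Real.rpow_add hu, one_div,
        one_div, add_comm, hpp.inv_add_inv_eq_one, Real.rpow_one]
    have hLap : Lap lam v ((Ioo s t).indicator fun y => v y ^ (p' - 1) / u ^ (1 / p)) x =
        ∫ y in Ioo s t, Real.exp (-(x * y ^ lam)) * g y := by
      have hpt (y : ℝ) : Real.exp (-(x * y ^ lam)) *
          (Ioo s t).indicator (fun y => v y ^ (p' - 1) / u ^ (1 / p)) y * v y =
          (Ioo s t).indicator (fun y => Real.exp (-(x * y ^ lam)) * g y) y := by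
        by_cases hy : y ∈ Ioo s t
        · rw [indicator_of_mem hy, indicator_of_mem hy, hg]
          have := Real.rpow_add_one' (hvpos y) (y := p' - 1) (by linarith)
          rw [sub_add_cancel] at this
          simp only [this]
          ring
        · simp [hy]
      simp_rw [Lap, hpt]
      rw [integral_indicator measurableSet_Ioo, Measure.restrict_restrict measurableSet_Ioo,
        inter_eq_left.2 hsub]
    have hei : IntegrableOn (fun y => Real.exp (-(x * y ^ lam)) * g y) (Ioo s t) := by
      refine hgi.mono' (by fun_prop) ?_
      filter_upwards [ae_restrict_mem measurableSet_Ioo] with y hy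
      have hy0 : 0 < y := hsub hy
      rw [Real.norm_eq_abs, abs_of_nonneg (mul_nonneg (Real.exp_nonneg _) (hg0 y))]
      refine mul_le_of_le_one_left (hg0 y) (Real.exp_le_one_iff.2 ?_)
      rw [neg_nonpos]; positivity
    rw [hLap, ← hgint, ← integral_const_mul, ← integral_const_mul]
    constructor
    · refine setIntegral_mono_on (hgi.const_mul _) hei measurableSet_Ioo fun y hy => ?_
      have hy0 : 0 < y := hsub hy
      refine mul_le_mul_of_nonneg_right (Real.exp_le_exp.2 (neg_le_neg ?_)) (hg0 y)
      exact mul_le_mul_of_nonneg_left (Real.rpow_le_rpow hy0.le hy.2.le hlam.le) hx.le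
    · refine setIntegral_mono_on hei (hgi.const_mul _) measurableSet_Ioo fun y hy => ?_
      refine mul_le_mul_of_nonneg_right (Real.exp_le_exp.2 (neg_le_neg ?_)) (hg0 y)
      exact mul_le_mul_of_nonneg_left (Real.rpow_le_rpow hs.le hy.1.le hlam.le) hx.le

lemma ofReal_setIntegral_rpow {p' : ℝ} (hp' : 0 ≤ p') {v : ℝ → ℝ} (hvpos : ∀ y, 0 ≤ v y)
    {E : Set ℝ} (hvint : IntegrableOn (fun y => v y ^ p') E) :
    ENNReal.ofReal (∫ y in E, v y ^ p') = ∫⁻ y in E, ENNReal.ofReal (v y) ^ p' := by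
  rw [ofReal_integral_eq_lintegral_ofReal hvint
    (Eventually.of_forall fun y => by have := hvpos y; simp only [Pi.zero_apply]; positivity)]
  exact lintegral_congr fun y => (ENNReal.ofReal_rpow_of_nonneg (hvpos y) hp').symm

lemma exists_lt_rpow_mul_setIntegral {lam p' q : ℝ} (hp' : 0 < p')
    {v : ℝ → ℝ} (hvpos : ∀ y, 0 ≤ v y)
    (hloc : LocallyIntegrableOn (fun y => v y ^ p') (Ioi (0:ℝ))) {t δ : ℝ} (ht : 0 < t)
    (h : ENNReal.ofReal δ < (ENNReal.ofReal t) ^ (-(lam/q)) *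
      (∫⁻ y in Ioo (0:ℝ) t, ENNReal.ofReal (v y) ^ p') ^ (1/p')) :
    ∃ s, 0 < s ∧ δ < t ^ (-(lam / q)) * (∫ y in Ioo s t, v y ^ p') ^ (1 / p') := by
  have hmono : Monotone fun k : ℕ => Ioo (1 / ((k:ℝ) + 1)) t := fun k l hkl =>
    Ioo_subset_Ioo_left (one_div_le_one_div_of_le (by positivity) (by gcongr))
  have hU : (⋃ k : ℕ, Ioo (1 / ((k:ℝ) + 1)) t) = Ioo 0 t := by
    ext y
    simp only [mem_iUnion, mem_Ioo]
    constructor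
    · rintro ⟨k, hk, hyt⟩
      exact ⟨lt_trans (by positivity) hk, hyt⟩
    · rintro ⟨hy, hyt⟩
      obtain ⟨k, hk⟩ := exists_nat_one_div_lt hy
      exact ⟨k, hk, hyt⟩
  have hlim : Tendsto (fun k : ℕ => ∫⁻ y in Ioo (1 / ((k:ℝ) + 1)) t, ENNReal.ofReal (v y) ^ p')
      atTop (𝓝 (∫⁻ y in Ioo (0:ℝ) t, ENNReal.ofReal (v y) ^ p')) := by
    rw [← hU, setLIntegral_iUnion_of_directed _ hmono.directed_le]
    exact tendsto_atTop_iSup fun k l hkl => lintegral_mono_set (hmono hkl)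
  rw [ENNReal.ofReal_rpow_of_pos ht] at h
  have hlim2 := ENNReal.Tendsto.const_mul (a := ENNReal.ofReal (t ^ (-(lam / q))))
    ((ENNReal.continuous_rpow_const (y := 1 / p')).tendsto _ |>.comp hlim)
    (Or.inr ENNReal.ofReal_ne_top)
  obtain ⟨k, hk⟩ := (hlim2.eventually (lt_mem_nhds h)).exists
  have hs : (0:ℝ) < 1 / ((k:ℝ) + 1) := by positivity
  refine ⟨1 / ((k:ℝ) + 1), hs, ?_⟩
  have hvint : IntegrableOn (fun y => v y ^ p') (Ioo (1 / ((k:ℝ) + 1)) t) :=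
    (hloc.integrableOn_compact_subset (t := Icc (1 / ((k:ℝ) + 1)) t)
      (fun y hy => hs.trans_le hy.1) isCompact_Icc).mono_set Ioo_subset_Icc_self
  have hu : 0 ≤ ∫ y in Ioo (1 / ((k:ℝ) + 1)) t, v y ^ p' :=
    integral_nonneg fun y => Real.rpow_nonneg (hvpos y) _
  rw [Function.comp_apply, ← ofReal_setIntegral_rpow hp'.le hvpos hvint,
    ENNReal.ofReal_rpow_of_nonneg hu (by positivity), ← ENNReal.ofReal_mul (by positivity)] at hk
  exact (ENNReal.ofReal_lt_ofReal_iff'.1 hk).1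

lemma ofReal_le_eN_of_le_on_Ioo {q a d : ℝ} (hq : 0 < q) (ha : 0 < a) (hd : 0 ≤ d) {g : ℝ → ℝ}
    (hg : ∀ x ∈ Ioo a (2 * a), d * a ^ (-(1 / q)) ≤ g x) : ENNReal.ofReal d ≤ eN q g := by
  have hlow : ENNReal.ofReal d ^ q ≤ ∫⁻ x in Ioi (0:ℝ), ENNReal.ofReal |g x| ^ q := by
    calc ENNReal.ofReal d ^ q = ∫⁻ x in Ioo a (2 * a), ENNReal.ofReal (d * a ^ (-(1 / q))) ^ q := by
          rw [setLIntegral_const, Real.volume_Ioo, ENNReal.ofReal_rpow_of_nonneg hd hq.le,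
            ENNReal.ofReal_rpow_of_nonneg (by positivity) hq.le,
            ← ENNReal.ofReal_mul (by positivity), Real.mul_rpow hd (by positivity),
            ← Real.rpow_mul ha.le, neg_mul, one_div_mul_cancel hq.ne', Real.rpow_neg_one]
          congr 1
          field_simp
          ring
      _ ≤ ∫⁻ x in Ioo a (2 * a), ENNReal.ofReal |g x| ^ q := by
          refine setLIntegral_mono' measurableSet_Ioo fun x hx => ?_
          gcongr
          exact (hg x hx).trans (le_abs_self _)
      _ ≤ _ := lintegral_mono_set fun x hx => ha.trans hx.1
  have := ENNReal.rpow_le_rpow hlow (show 0 ≤ 1 / q by positivity)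
  rwa [← ENNReal.rpow_mul, mul_one_div_cancel hq.ne', ENNReal.rpow_one] at this

/-- Compactness forces `A` to vanish along every filter on `(0,∞)` along which the bumps
`t^{λ/q} e^{-x t^λ}` escape from each fixed exponentially decaying function. -/
lemma tendsto_zero_of_lapCompact {lam p p' q : ℝ} (hlam : 0 < lam) (hpq : p ≤ q)
    (hpp : p.HolderConjugate p') {v : ℝ → ℝ} (hv : Measurable v) (hvpos : ∀ y, 0 ≤ v y)
    (hloc : LocallyIntegrableOn (fun y => v y ^ p') (Ioi (0:ℝ)))
    {A : ℝ → ℝ≥0∞}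
    (hA : A = fun t => (ENNReal.ofReal t) ^ (-(lam/q)) *
      (∫⁻ y in Ioo (0:ℝ) t, ENNReal.ofReal (v y) ^ p') ^ (1/p'))
    (hcomp : LapCompact lam p q v) {l : Filter ℝ} [l.IsCountablyGenerated]
    (hl0 : ∀ᶠ t in l, 0 < t)
    (hl : ∀ b, 0 < b →
      Tendsto (fun t : ℝ => (t ^ (-lam)) ^ (1 / q) * Real.exp (-b * t ^ (-lam))) l (𝓝 0)) :
    Tendsto A l (𝓝 0) := by
  have hp0 := hpp.pos
  have hp0' := hpp.symm.pos
  have hq : 0 < q := hp0.trans_le hpq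
  rw [ENNReal.tendsto_nhds_zero]
  by_contra! hcon
  obtain ⟨ε, hε, hfreq⟩ := hcon
  obtain ⟨δ, hr0, hrε⟩ := ENNReal.lt_iff_exists_nnreal_btwn.1 hε
  have hδ : (0:ℝ) < δ := by exact_mod_cast hr0
  obtain ⟨t, htl, ht⟩ := exists_seq_forall_of_frequently (hfreq.and_eventually hl0)
  have hδA (n : ℕ) : ENNReal.ofReal δ < ENNReal.ofReal (t n) ^ (-(lam/q)) *
      (∫⁻ y in Ioo (0:ℝ) (t n), ENNReal.ofReal (v y) ^ p') ^ (1/p') := by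
    have h1 := hrε.trans (ht n).1
    rw [hA] at h1
    rwa [ENNReal.ofReal_coe_nnreal]
  choose s hs hsδ using fun n =>
    exists_lt_rpow_mul_setIntegral (lam := lam) (q := q) hp0' hvpos hloc (ht n).2 (hδA n)
  set u : ℕ → ℝ := fun n => ∫ y in Ioo (s n) (t n), v y ^ p' with hu
  have hu0 (n : ℕ) : 0 < u n := by
    have h0 : 0 ≤ u n := integral_nonneg fun y => Real.rpow_nonneg (hvpos y) _
    refine h0.lt_of_ne fun h => ?_
    have h1 : δ < t n ^ (-(lam / q)) * u n ^ (1 / p') := hsδ n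
    rw [← h, Real.zero_rpow (by positivity), mul_zero] at h1
    exact lt_asymm hδ h1
  choose f hfm hfn hfL using fun n => exists_extremal_function (lam := lam) hlam hpp hv hvpos (hs n)
    ((hloc.integrableOn_compact_subset (t := Icc (s n) (t n))
      (fun y hy => (hs n).trans_le hy.1) isCompact_Icc).mono_set Ioo_subset_Icc_self) (hu0 n)
  obtain ⟨φ, hφ, hcau⟩ := hcomp f hfm hfn
  set d : ℝ := Real.exp (-2) * δ / 2 with hd
  have hd0 : 0 < d := by positivity
  obtain ⟨N, hN⟩ := hcau d hd0
  have hsN : 0 < s (φ N) ^ lam := Real.rpow_pos_of_pos (hs _) _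
  have huN : 0 < u (φ N) ^ (1 / p') := Real.rpow_pos_of_pos (hu0 _) _
  have hsmall := (((hl _ hsN).comp (htl.comp hφ.tendsto_atTop)).const_mul
    (u (φ N) ^ (1 / p'))).eventually (gt_mem_nhds (by simpa using hd0))
  obtain ⟨m, hm, hmN⟩ := (hsmall.and (eventually_ge_atTop N)).exists
  refine (hN m hmN N le_rfl).not_ge ?_
  have htm : 0 < t (φ m) := (ht _).2
  set a := t (φ m) ^ (-lam) with ha
  have ha0 : 0 < a := by positivity
  have hat : a * t (φ m) ^ lam = 1 := by
    rw [ha, ← Real.rpow_add htm]; simp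
  have hm : u (φ N) ^ (1 / p') * (a ^ (1 / q) * Real.exp (-s (φ N) ^ lam * a)) < d := hm
  refine ofReal_le_eN_of_le_on_Ioo hq ha0 hd0.le fun x hx => ?_
  have hx0 : 0 < x := ha0.trans hx.1
  have hup : Lap lam v (f (φ N)) x ≤ d * a ^ (-(1 / q)) := by
    calc Lap lam v (f (φ N)) x ≤ Real.exp (-(x * s (φ N) ^ lam)) * u (φ N) ^ (1 / p') :=
          (hfL _ x hx0).2
      _ ≤ Real.exp (-s (φ N) ^ lam * a) * u (φ N) ^ (1 / p') := by
          refine mul_le_mul_of_nonneg_right (Real.exp_le_exp.2 ?_) huN.le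
          nlinarith [hx.1]
      _ = u (φ N) ^ (1 / p') * (a ^ (1 / q) * Real.exp (-s (φ N) ^ lam * a)) *
          a ^ (-(1 / q)) := by
          have : a ^ (1 / q) * a ^ (-(1 / q)) = 1 := by rw [← Real.rpow_add ha0]; simp
          linear_combination
            (-(u (φ N) ^ (1 / p') * Real.exp (-s (φ N) ^ lam * a))) * this
      _ ≤ d * a ^ (-(1 / q)) := by gcongr
  have hlow : 2 * (d * a ^ (-(1 / q))) ≤ Lap lam v (f (φ m)) x := by
    refine le_trans ?_ (hfL _ x hx0).1
    have h1 : Real.exp (-2) ≤ Real.exp (-(x * t (φ m) ^ lam)) := by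
      apply Real.exp_le_exp.2
      have : x * t (φ m) ^ lam ≤ 2 * a * t (φ m) ^ lam :=
        mul_le_mul_of_nonneg_right hx.2.le (by positivity)
      linarith
    have h2 : δ * a ^ (-(1 / q)) ≤ u (φ m) ^ (1 / p') := by
      have e1 : a ^ (-(1 / q)) * t (φ m) ^ (-(lam / q)) = 1 := by
        rw [ha, ← Real.rpow_mul htm.le, ← Real.rpow_add htm,
          show -lam * -(1 / q) + -(lam / q) = 0 by ring, Real.rpow_zero]
      calc δ * a ^ (-(1 / q)) ≤
            t (φ m) ^ (-(lam / q)) * u (φ m) ^ (1 / p') * a ^ (-(1 / q)) := by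
            gcongr; exact (hsδ (φ m)).le
        _ = u (φ m) ^ (1 / p') := by linear_combination (u (φ m) ^ (1 / p')) * e1
    calc 2 * (d * a ^ (-(1 / q))) = Real.exp (-2) * (δ * a ^ (-(1 / q))) := by rw [hd]; ring
      _ ≤ _ := mul_le_mul h1 h2 (by positivity) (Real.exp_nonneg _)
  linarith

lemma iSup_lt_top_of_tendsto {lam p' q : ℝ} (hlam : 0 < lam) (hp' : 0 < p') (hq : 0 < q)
    {v : ℝ → ℝ} (hvpos : ∀ y, 0 ≤ v y)
    (hloc : LocallyIntegrableOn (fun y => v y ^ p') (Ioi (0:ℝ)))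
    {A : ℝ → ℝ≥0∞}
    (hA : A = fun t => (ENNReal.ofReal t) ^ (-(lam/q)) *
      (∫⁻ y in Ioo (0:ℝ) t, ENNReal.ofReal (v y) ^ p') ^ (1/p'))
    (h0 : Tendsto A (𝓝[>] 0) (𝓝 0)) (hinf : Tendsto A atTop (𝓝 0)) :
    (⨆ t ∈ Ioi (0:ℝ), A t) < ⊤ := by
  obtain ⟨a, ha0, ha⟩ := mem_nhdsGT_iff_exists_Ioo_subset.1
    (ENNReal.tendsto_nhds_zero.1 h0 1 one_pos)
  have ha0 : 0 < a := ha0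
  obtain ⟨b, hb⟩ := eventually_atTop.1 (ENNReal.tendsto_nhds_zero.1 hinf 1 one_pos)
  set W : ℝ → ℝ≥0∞ := fun t => ∫⁻ y in Ioo (0:ℝ) t, ENNReal.ofReal (v y) ^ p' with hW
  have hWa : W (a / 2) ≠ ⊤ := by
    have h1 : A (a / 2) ≤ 1 := ha ⟨by positivity, by linarith⟩
    have h2 := eq_ofReal_rpow_mul_rpow (lam := lam) hp' hq (half_pos ha0) (W (a / 2))
    rw [show ENNReal.ofReal (a / 2) ^ (-(lam / q)) * W (a / 2) ^ (1 / p') = A (a / 2) by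
      rw [hA]] at h2
    rw [h2]
    exact ENNReal.mul_ne_top ENNReal.ofReal_ne_top
      (ENNReal.rpow_ne_top_of_nonneg hp'.le (h1.trans_lt ENNReal.one_lt_top).ne)
  have hWb : W b ≠ ⊤ := by
    have hvint : IntegrableOn (fun y => v y ^ p') (Icc (a / 2) b) :=
      hloc.integrableOn_compact_subset (fun y hy => (half_pos ha0).trans_le hy.1) isCompact_Icc
    have h1 : W b ≤ W (a / 2) + ∫⁻ y in Icc (a / 2) b, ENNReal.ofReal (v y) ^ p' := by
      refine (lintegral_mono_set fun y hy => ?_).trans (lintegral_union_le _ _ _)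
      rcases lt_or_ge y (a / 2) with h | h
      · exact Or.inl ⟨hy.1, h⟩
      · exact Or.inr ⟨h, hy.2.le⟩
    rw [← ofReal_setIntegral_rpow hp'.le hvpos hvint] at h1
    exact (h1.trans_lt (ENNReal.add_lt_top.2 ⟨hWa.lt_top, ENNReal.ofReal_lt_top⟩)).ne
  set M := max 1 (ENNReal.ofReal (a ^ (-(lam / q))) * W b ^ (1 / p'))
  have hM : M < ⊤ := max_lt ENNReal.one_lt_top (ENNReal.mul_lt_top ENNReal.ofReal_lt_top
    (ENNReal.rpow_ne_top_of_nonneg (by positivity) hWb).lt_top)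
  refine lt_of_le_of_lt (iSup₂_le fun t ht => ?_) hM
  have ht : 0 < t := ht
  rcases lt_or_ge t a with hta | hta
  · exact (show A t ≤ 1 from ha ⟨ht, hta⟩).trans (le_max_left _ _)
  rcases le_or_gt b t with htb | htb
  · exact (hb t htb).trans (le_max_left _ _)
  · refine le_trans ?_ (le_max_right _ _)
    rw [hA]
    beta_reduce
    rw [ENNReal.ofReal_rpow_of_pos ht]
    refine mul_le_mul' (ENNReal.ofReal_le_ofReal
      (Real.rpow_le_rpow_of_nonpos ha0 hta (neg_nonpos.2 (by positivity)))) ?_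
    exact ENNReal.rpow_le_rpow (lintegral_mono_set (Ioo_subset_Ioo_right htb.le)) (by positivity)

theorem stmt5 (lam p q : ℝ) (hlam : 0 < lam) (hp : 1 < p) (hpq : p ≤ q)
    (v : ℝ → ℝ) (hv : Measurable v) (hvpos : ∀ y, 0 ≤ v y)
    (p' : ℝ) (hp' : p' = p / (p - 1))
    (hloc : LocallyIntegrableOn (fun y => v y ^ p') (Ioi (0:ℝ)))
    (A : ℝ → ℝ≥0∞)
    -- `A(t) = t^{-λ/q} (∫_0^t v^{p'})^{1/p'}`
    (hA : A = fun t => (ENNReal.ofReal t) ^ (-(lam/q)) *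
      (∫⁻ y in Ioo (0:ℝ) t, ENNReal.ofReal (v y) ^ p') ^ (1/p')) :
    LapCompact lam p q v ↔
      (⨆ t ∈ Ioi (0:ℝ), A t) < ⊤
        ∧ Tendsto A (nhdsWithin 0 (Ioi 0)) (nhds 0)
        ∧ Tendsto A atTop (nhds 0) := by
  have hpp : p.HolderConjugate p' := by
    rw [hp']; exact Real.HolderConjugate.conjExponent hp
  have hq : 0 < q := by linarith
  have hq' : 0 < 1 / q := by positivity
  constructor
  · intro hcomp
    have h0 : Tendsto A (𝓝[>] 0) (𝓝 0) :=
      tendsto_zero_of_lapCompact hlam hpq hpp hv hvpos hloc hA hcomp self_mem_nhdsWithin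
        fun b hb => (tendsto_rpow_mul_exp_neg_mul_atTop_nhds_zero (1 / q) b hb).comp
          (tendsto_rpow_neg_nhdsGT_zero (neg_neg_of_pos hlam))
    have hinf : Tendsto A atTop (𝓝 0) := by
      refine tendsto_zero_of_lapCompact hlam hpq hpp hv hvpos hloc hA hcomp
        (eventually_gt_atTop 0) fun b _ => ?_
      refine (tendsto_rpow_mul_exp_neg_mul_nhdsGT_zero hq' b).comp (tendsto_nhdsWithin_iff.2
        ⟨tendsto_rpow_neg_atTop hlam, ?_⟩)
      filter_upwards [eventually_gt_atTop (0:ℝ)] with t ht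
      exact Real.rpow_pos_of_pos ht _
    exact ⟨iSup_lt_top_of_tendsto hlam hpp.symm.pos hq hvpos hloc hA h0 hinf, h0, hinf⟩
  · rintro ⟨hsup, h0, hinf⟩
    exact lapCompact_of_tendsto hlam hpq hpp hv hvpos hA hsup h0 hinf
end
end
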